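/- arXiv:1903.09904 — 7 statements merged into one kernel-verified Lean document; each statement's English description precedes it below -/
import Mathlib

section
/- Let σ ∈ Sp(B,k) be a diagonal involution (σ² = id, σ ≠ id, and B(v, σ(v)) ≠ 0 for some v ∈ V), and let r = dim R_σ where R_σ = (σ − id)V is the residual space of σ. Then there exist vectors u₁, …, u_r forming a basis of R_σ with B(u_i, u_j) = 0 for all i, j, and nonzero scalars a₁, …, a_r ∈ k, such that σ = τ_{u_r,a_r} ∘ ⋯ ∘ τ_{u_2,a_2} ∘ τ_{u_1,a_1}. -/
open QuadraticMap

/-- The symplectic transvection `τ_{u,a} : w ↦ w + a·B(u,w)·u`, where `B = polar Q` is the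
bilinear form associated to the quadratic form `Q`. -/
noncomputable def sympTransvection {k V : Type*} [Field k] [AddCommGroup V] [Module k V]
    (Q : QuadraticForm k V) (u : V) (a : k) : Module.End k V :=
  LinearMap.id + a • (polarBilin Q u).smulRight u

theorem sympTransvection_apply {k V : Type*} [Field k] [AddCommGroup V] [Module k V]
    (Q : QuadraticForm k V) (u : V) (a : k) (w : V) :
    sympTransvection Q u a w = w + (a * polar Q u w) • u := by
  simp [sympTransvection, smul_smul]

/-- A composite of symplectic transvections with pairwise orthogonal inducing vectors adds up
their displacements. -/
theorem prod_sympTransvection_apply {k V : Type*} [Field k] [AddCommGroup V] [Module k V]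
    (Q : QuadraticForm k V) {n : ℕ} (u : Fin n → V) (a : Fin n → k)
    (hu : ∀ i j, polar Q (u i) (u j) = 0) (w : V) :
    (List.ofFn fun i => sympTransvection Q (u i) (a i)).reverse.prod w =
      w + ∑ i, (a i * polar Q (u i) w) • u i := by
  induction n generalizing w with
  | zero => simp
  | succ n ih =>
    rw [List.ofFn_succ, List.reverse_cons, List.prod_append, List.prod_singleton,
      Module.End.mul_apply, ih _ _ fun i j => hu i.succ j.succ, Fin.sum_univ_succ,
      sympTransvection_apply, add_assoc]
    simp [polar_add_right, polar_smul_right, hu]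

/-- A nondegenerate symmetric bilinear form having an anisotropic vector `x` with nonzero orthogonal
complement has a pair of orthogonal anisotropic vectors. -/
theorem LinearMap.BilinForm.exists_anisotropic_orthogonal_pair {K V : Type*} [Field K]
    [AddCommGroup V] [Module K V] {B : LinearMap.BilinForm K V} (hs : B.IsSymm)
    (hB : B.Nondegenerate) {x : V} (hx : B x x ≠ 0)
    [Nontrivial (B.orthogonal (Submodule.span K {x}))] :
    ∃ y z, B y y ≠ 0 ∧ B z z ≠ 0 ∧ B y z = 0 := by
  by_cases hz : ∃ z, B x z = 0 ∧ B z z ≠ 0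
  · obtain ⟨z, hxz, hz⟩ := hz
    exact ⟨x, z, hx, hz, hxz⟩
  push Not at hz
  have mem {y : V} : y ∈ B.orthogonal (Submodule.span K {x}) ↔ B x y = 0 := by
    refine ⟨fun h => h x (Submodule.mem_span_singleton_self x), fun h z hz => ?_⟩
    obtain ⟨c, rfl⟩ := Submodule.mem_span_singleton.1 hz
    simp [h]
  have hne := (B.restrict_nondegenerate_orthogonal_spanSingleton hB hs.isRefl hx).ne_zero
  obtain ⟨y, hy⟩ := DFunLike.ne_iff.1 hne
  obtain ⟨z, hyz⟩ := DFunLike.ne_iff.1 hy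
  obtain ⟨y, hxy⟩ := y
  obtain ⟨z, hxz⟩ := z
  rw [mem] at hxy hxz
  replace hyz : B y z ≠ 0 := hyz
  have hyx : B y x = 0 := by rw [hs.eq, hxy]
  have hzx : B z x = 0 := by rw [hs.eq, hxz]
  refine ⟨x + y, x + (-(B x x) / B y z) • z, ?_, ?_, ?_⟩
  · simpa [hxy, hyx, hz y hxy] using hx
  · simpa [hxz, hzx, hz z hxz] using hx
  · simp [hxz, hyx, hyz]

/-- **Albert's theorem**: a nondegenerate symmetric bilinear form which is not alternating admits
an orthogonal basis, over a field of any characteristic. -/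
theorem LinearMap.BilinForm.exists_orthogonal_basis_of_not_isAlt {K V : Type*} [Field K]
    [AddCommGroup V] [Module K V] [FiniteDimensional K V] {B : LinearMap.BilinForm K V}
    (hs : B.IsSymm) (hB : B.Nondegenerate) (halt : ∃ x, B x x ≠ 0) {d : ℕ}
    (hd : Module.finrank K V = d) :
    ∃ v : Module.Basis (Fin d) K V, B.iIsOrtho v := by
  induction d generalizing V with
  | zero => exact ⟨basisOfFinrankZero hd, fun i => i.elim0⟩
  | succ d ih =>
    obtain ⟨x, hx, hx'⟩ : ∃ x, B x x ≠ 0 ∧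
        (d = 0 ∨ ∃ z : B.orthogonal (Submodule.span K {x}), B z z ≠ 0) := by
      obtain ⟨x, hx⟩ := halt
      rcases Nat.eq_zero_or_pos d with h0 | h0
      · exact ⟨x, hx, .inl h0⟩
      have : Nontrivial (B.orthogonal (Submodule.span K {x})) := by
        have h := Submodule.finrank_add_eq_of_isCompl (isCompl_span_singleton_orthogonal hx)
        rw [hd, finrank_span_singleton (ne_zero_of_map hx)] at h
        exact Module.nontrivial_of_finrank_pos (R := K) (by omega)
      obtain ⟨y, z, hy, hz, hyz⟩ := exists_anisotropic_orthogonal_pair hs hB hx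
      refine ⟨y, hy, .inr ⟨⟨z, ?_⟩, hz⟩⟩
      simp [LinearMap.BilinForm.mem_orthogonal_iff, Submodule.mem_span_singleton, hyz]
    have hc := isCompl_span_singleton_orthogonal hx
    have hfr := Submodule.finrank_add_eq_of_isCompl hc
    rw [hd, finrank_span_singleton (ne_zero_of_map hx)] at hfr
    obtain ⟨v, hv⟩ : ∃ v : Module.Basis (Fin d) K (B.orthogonal (Submodule.span K {x})),
        (B.restrict (B.orthogonal (Submodule.span K {x}))).iIsOrtho v := by
      rcases hx' with rfl | hz
      · exact ⟨basisOfFinrankZero (by omega), fun i => i.elim0⟩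
      · exact ih ⟨fun y z => hs.eq y z⟩
          (B.restrict_nondegenerate_orthogonal_spanSingleton hB hs.isRefl hx) hz (by omega)
    have hxv (i : Fin d) : B x (v i) = 0 := (v i).2 x (Submodule.mem_span_singleton_self x)
    refine ⟨Module.Basis.mkFinCons x v ?_ ?_, ?_⟩
    · intro c y hy h
      have hxy : B x y = 0 := hy x (Submodule.mem_span_singleton_self x)
      simpa [hxy, hx] using congrArg (B x) h
    · intro y
      refine ⟨-B x y / B x x, fun z hz => ?_⟩
      obtain ⟨c, rfl⟩ := Submodule.mem_span_singleton.1 hz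
      simp [hx]
    · rw [iIsOrtho_def, Module.Basis.coe_mkFinCons]
      intro i j hij
      cases i using Fin.cases with
      | zero =>
        cases j using Fin.cases with
        | zero => exact (hij rfl).elim
        | succ j => exact hxv j
      | succ i =>
        cases j using Fin.cases with
        | zero => exact (hs.eq _ _).trans (hxv i)
        | succ j => exact hv (ne_of_apply_ne _ hij)

/-- A self-adjoint square-zero endomorphism `N` for which `v ↦ B(v, N v)` does not vanish is a sum
of rank-one operators along an orthogonal basis of its range. -/
theorem exists_rankOne_decomposition_of_selfAdjoint
    {k V : Type*} [Field k] [AddCommGroup V] [Module k V] [FiniteDimensional k V]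
    (Q : QuadraticForm k V) (hns : ∀ v : V, (∀ w : V, polar Q v w = 0) → v = 0)
    (N : Module.End k V) (hNadj : ∀ v w, polar Q (N v) w = polar Q v (N w))
    (hNN : ∀ v, N (N v) = 0) (hdiag : ∃ v, polar Q v (N v) ≠ 0) :
    ∃ (u : Fin (Module.finrank k (LinearMap.range N)) → V)
      (a : Fin (Module.finrank k (LinearMap.range N)) → k),
      LinearIndependent k u ∧
      Submodule.span k (Set.range u) = LinearMap.range N ∧
      (∀ i j, polar Q (u i) (u j) = 0) ∧
      (∀ i, a i ≠ 0) ∧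
      ∀ w, N w = ∑ i, (a i * polar Q (u i) w) • u i := by
  obtain ⟨C, hC⟩ := (LinearMap.ker N).exists_isCompl
  replace hC := hC.symm
  let b : LinearMap.BilinForm k V := (polarBilin Q).compl₂ N
  have hb (v w : V) : b v w = polar Q v (N w) := rfl
  have hbs : b.IsSymm := ⟨fun v w => by rw [hb, hb, ← hNadj, polar_comm]⟩
  have hdecomp (v : V) : ∃ c ∈ C, N v = N c := by
    obtain ⟨c, hc, n, hn, rfl⟩ := Submodule.mem_sup.1 (hC.sup_eq_top ▸ Submodule.mem_top : v ∈ _)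
    exact ⟨c, hc, by rw [map_add, LinearMap.mem_ker.1 hn, add_zero]⟩
  have hbC : (b.restrict C).IsSymm := ⟨fun v w => hbs.eq v w⟩
  have hnd : (b.restrict C).Nondegenerate := by
    refine (LinearMap.IsRefl.nondegenerate_iff_separatingLeft hbC.isRefl).2 ?_
    intro c hc
    have hNc : N c = 0 := hns _ fun w => by
      obtain ⟨c', hc', hw⟩ := hdecomp w
      rw [hNadj, hw]
      exact hc ⟨c', hc'⟩
    exact Subtype.ext (Submodule.disjoint_def.1 hC.disjoint c c.2 hNc)
  have halt : ∃ c, b.restrict C c c ≠ 0 := by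
    obtain ⟨v, hv⟩ := hdiag
    obtain ⟨c, hc, hvc⟩ := hdecomp v
    refine ⟨⟨c, hc⟩, fun h => hv ?_⟩
    replace h : polar Q c (N c) = 0 := h
    rw [hvc, ← hNadj, hvc, hNadj, h]
  obtain ⟨v, hv⟩ := LinearMap.BilinForm.exists_orthogonal_basis_of_not_isAlt hbC hnd halt
    (N.kerComplementEquivRange hC).finrank_eq
  obtain ⟨e, he⟩ : ∃ e : Module.Basis (Fin _) k (LinearMap.range N), ∀ i, (e i : V) = N (v i) :=
    ⟨v.map (N.kerComplementEquivRange hC), fun i => by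
      rw [Module.Basis.map_apply]
      rfl⟩
  have hc (i) : polar Q (v i) (N (v i)) ≠ 0 := hv.not_isOrtho_basis_self_of_nondegenerate hnd i
  have hvo (i j) (h : i ≠ j) : polar Q (v i) (N (v j)) = 0 := hv h
  have horth (i j) : polar Q (e i : V) (e j) = 0 := by
    rw [he, he, hNadj, hNN, polar_zero_right]
  refine ⟨fun i => e i, fun i => (polar Q (v i) (N (v i)))⁻¹,
    e.linearIndependent.map' _ (Submodule.ker_subtype _), ?_, horth,
    fun i => inv_ne_zero (hc i), ?_⟩
  · rw [show (fun i => (e i : V)) = (LinearMap.range N).subtype ∘ e from rfl, Set.range_comp,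
      Submodule.span_image, e.span_eq, Submodule.map_subtype_top]
  · intro w
    have hsum : N w = ∑ i, e.repr ⟨N w, w, rfl⟩ i • (e i : V) := by
      have h := congrArg (LinearMap.range N).subtype (e.sum_repr ⟨N w, w, rfl⟩)
      rw [map_sum] at h
      exact h.symm
    have hcoef (j) : polar Q (e j : V) w =
        e.repr ⟨N w, w, rfl⟩ j * polar Q (v j) (N (v j)) := by
      rw [he, hNadj, ← polarBilin_apply_apply]
      conv_lhs => rw [hsum]
      rw [map_sum, Finset.sum_eq_single j]
      · simp [he]
      · intro i _ hij
        simp [he, hvo j i hij.symm]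
      · simp
    conv_lhs => rw [hsum]
    refine Finset.sum_congr rfl fun i _ => ?_
    rw [hcoef, mul_comm, mul_assoc, mul_inv_cancel₀ (hc i), mul_one]

/-- a diagonal involution `σ` in `Sp(B,k)` is a product of
`r = dim R_σ` symplectic transvections with mutually orthogonal inducing vectors forming a
basis of the residual space `R_σ = (σ - id)V`. -/
theorem diagonal_involution_is_product_of_transvections
    {k V : Type*} [Field k] [CharP k 2] [AddCommGroup V] [Module k V] [FiniteDimensional k V]
    (Q : QuadraticForm k V)
    -- `V` is nonsingular: the radical of the associated bilinear form is trivial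
    (hns : ∀ v : V, (∀ w : V, polar Q v w = 0) → v = 0)
    -- `σ ∈ Sp(B,k)`
    (σ : Module.End k V) (hσbij : Function.Bijective σ)
    (hσB : ∀ v w : V, polar Q (σ v) (σ w) = polar Q v w)
    -- `σ` is an involution
    (hinv : σ * σ = 1) (hne : σ ≠ 1)
    -- `σ` is diagonal
    (hdiag : ∃ v : V, polar Q v (σ v) ≠ 0) :
    ∃ (u : Fin (Module.finrank k (LinearMap.range (σ - 1))) → V)
      (a : Fin (Module.finrank k (LinearMap.range (σ - 1))) → k),
      LinearIndependent k u ∧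
      Submodule.span k (Set.range u) = LinearMap.range (σ - 1) ∧
      (∀ i j, polar Q (u i) (u j) = 0) ∧
      (∀ i, a i ≠ 0) ∧
      σ = (List.ofFn fun i => sympTransvection Q (u i) (a i)).reverse.prod := by
  obtain ⟨N, hN⟩ : ∃ N, N = σ - 1 := ⟨_, rfl⟩
  have hσN (v : V) : σ v = v + N v := by simp [hN]
  have hσσ (v : V) : σ (σ v) = v := LinearMap.congr_fun hinv v
  have hNadj (v w : V) : polar Q (N v) w = polar Q v (N w) := by
    have h := hσB v (σ w)
    rw [hσσ] at h
    simp only [hN, LinearMap.sub_apply, Module.End.one_apply, polar_sub_left, polar_sub_right, h]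
  have hNN (v : V) : N (N v) = 0 := by
    have h2 : (2 : k) = 0 := CharTwo.two_eq_zero
    have h : σ v + σ v = (2 : k) • σ v := (two_smul k _).symm
    have h' : v + v = (2 : k) • v := (two_smul k _).symm
    simp only [hN, LinearMap.sub_apply, Module.End.one_apply, map_sub, hσσ]
    rw [show v - σ v - (σ v - v) = (v + v) - (σ v + σ v) by abel, h, h', h2]
    simp
  have hpself (v : V) : polar Q v v = 0 := by
    rw [polar_self, ← Nat.cast_smul_eq_nsmul k]
    simp [CharTwo.two_eq_zero]
  obtain ⟨u, a, hu, hspan, horth, ha, hsum⟩ :=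
    exists_rankOne_decomposition_of_selfAdjoint Q hns N hNadj hNN <| by
      obtain ⟨v, hv⟩ := hdiag
      exact ⟨v, by rwa [hσN, polar_add_right, hpself, zero_add] at hv⟩
  subst hN
  refine ⟨u, a, hu, hspan, horth, ha, LinearMap.ext fun w => ?_⟩
  rw [prod_sympTransvection_apply Q _ _ horth, hσN, hsum]
end

section
/- Let u₁, …, u_l and x₁, …, x_l be two families of linearly independent vectors in V with B(u_i, u_j) = 0 and B(x_i, x_j) = 0 for all i, j, and let a₁, …, a_l, b₁, …, b_l ∈ k be nonzero. Set τ_{U,a} = τ_{u_l,a_l} ∘ ⋯ ∘ τ_{u_1,a_1} and τ_{X,b} = τ_{x_l,b_l} ∘ ⋯ ∘ τ_{x_1,b_1}. Then τ_{U,a} = τ_{X,b} if and only if span{u₁,…,u_l} = span{x₁,…,x_l} and, writing u_i = Σ_j α_{ji}·x_j, the coefficients satisfy b_j = Σ_i a_i·α_{ji}² for all j, and Σ_i a_i·α_{ji}·α_{mi} = 0 for all j ≠ m. -/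
open QuadraticMap

/-- A product of transvections along mutually orthogonal vectors is the identity plus the sum of
their rank-one parts. -/
theorem sympTransvection_prod_apply {k V : Type*} [Field k] [AddCommGroup V] [Module k V]
    (Q : QuadraticForm k V) {l : ℕ} (u : Fin l → V) (a : Fin l → k)
    (huB : ∀ i j, polar Q (u i) (u j) = 0) (w : V) :
    (List.ofFn fun i => sympTransvection Q (u i) (a i)).reverse.prod w =
      w + ∑ i, (a i * polar Q (u i) w) • u i := by
  induction l generalizing w with
  | zero => simp
  | succ l ih =>
    rw [List.ofFn_succ, List.reverse_cons, List.prod_append, List.prod_singleton,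
      Module.End.mul_apply, sympTransvection_apply,
      ih (fun i => u i.succ) (fun i => a i.succ) (fun i j => huB _ _), Fin.sum_univ_succ, add_assoc]
    simp [polar_add_right, polar_smul_right, huB]

/-- Every linearly independent family in a nonsingular space has a dual family. -/
theorem exists_polar_eq_single {k V : Type*} [Field k] [AddCommGroup V] [Module k V]
    [FiniteDimensional k V] (Q : QuadraticForm k V)
    (hns : ∀ v : V, (∀ w : V, polar Q v w = 0) → v = 0)
    {ι : Type*} [DecidableEq ι] {u : ι → V} (hu : LinearIndependent k u) (j : ι) :
    ∃ w : V, ∀ i, polar Q (u i) w = if i = j then 1 else 0 := by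
  have hinj : Function.Injective (polarBilin Q) := by
    rw [← LinearMap.ker_eq_bot, LinearMap.ker_eq_bot']
    intro v hv
    exact hns v fun w => by simpa using LinearMap.congr_fun hv w
  have hsurj : Function.Surjective (polarBilin Q) :=
    (LinearMap.injective_iff_surjective_of_finrank_eq_finrank
      (Subspace.dual_finrank_eq (K := k) (V := V)).symm).1 hinj
  obtain ⟨g, hg⟩ := LinearMap.exists_extend ((Module.Basis.span hu).coord j)
  obtain ⟨w, hw⟩ := hsurj g
  refine ⟨w, fun i => ?_⟩
  rw [polar_comm, ← polarBilin_apply_apply, hw]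
  have h := LinearMap.congr_fun hg (Module.Basis.span hu i)
  rw [Module.Basis.coord_apply, Module.Basis.repr_self, Finsupp.single_apply,
    LinearMap.comp_apply, Submodule.subtype_apply, Module.Basis.span_apply] at h
  exact h

/-- If the rank-one sums attached to two families agree, the first family, provided it is
independent with nonzero coefficients, lies in the span of the second. -/
theorem span_le_span_of_sum_polar_eq {k V : Type*} [Field k] [AddCommGroup V] [Module k V]
    [FiniteDimensional k V] (Q : QuadraticForm k V)
    (hns : ∀ v : V, (∀ w : V, polar Q v w = 0) → v = 0)
    {ι κ : Type*} [Fintype ι] [Fintype κ] {u : ι → V} {x : κ → V} {a : ι → k} {b : κ → k}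
    (hu : LinearIndependent k u) (ha : ∀ i, a i ≠ 0)
    (h : ∀ w, ∑ i, (a i * polar Q (u i) w) • u i = ∑ j, (b j * polar Q (x j) w) • x j) :
    Submodule.span k (Set.range u) ≤ Submodule.span k (Set.range x) := by
  classical
  rw [Submodule.span_le]
  rintro _ ⟨i, rfl⟩
  obtain ⟨w, hw⟩ := exists_polar_eq_single Q hns hu i
  have hi : a i • u i = ∑ j, (b j * polar Q (x j) w) • x j := by
    rw [← h w]
    simp [hw]
  rw [SetLike.mem_coe, ← Submodule.smul_mem_iff _ (ha i), hi]
  exact Submodule.sum_mem _ fun j _ =>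
    Submodule.smul_mem _ _ (Submodule.subset_span (Set.mem_range_self j))

theorem sum_polar_smul_eq_of_eq_sum {k V : Type*} [Field k] [AddCommGroup V] [Module k V]
    (Q : QuadraticForm k V) {ι κ : Type*} [Fintype ι] [Fintype κ] {u : ι → V} {x : κ → V}
    (a : ι → k) {α : κ → ι → k} (hα : ∀ i, u i = ∑ j, α j i • x j) (w : V) :
    ∑ i, (a i * polar Q (u i) w) • u i =
      ∑ m, (∑ j, (∑ i, a i * α j i * α m i) * polar Q (x j) w) • x m := by
  have hp : ∀ i, polar Q (u i) w = ∑ j, α j i * polar Q (x j) w := fun i => by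
    rw [hα i, ← polarBilin_apply_apply]
    simp
  have hs : ∀ i, (a i * polar Q (u i) w) • u i =
      ∑ m, (∑ j, a i * α j i * α m i * polar Q (x j) w) • x m := fun i => by
    rw [hp, hα i, Finset.smul_sum]
    refine Finset.sum_congr rfl fun m _ => ?_
    rw [smul_smul, Finset.mul_sum, Finset.sum_mul]
    exact congrArg (· • x m) (Finset.sum_congr rfl fun j _ => by ring)
  simp_rw [hs]
  rw [Finset.sum_comm]
  refine Finset.sum_congr rfl fun m _ => ?_
  rw [← Finset.sum_smul, Finset.sum_comm]
  simp_rw [Finset.sum_mul]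

/-- two products of symplectic transvections with mutually orthogonal,
linearly independent inducing vectors and nonzero coefficients are equal iff the inducing
families span the same subspace and the coefficients of the change of basis satisfy the
"involution compatible" conditions. -/
theorem sympTransvection_products_eq_iff_involution_compatible
    {k V : Type*} [Field k] [CharP k 2] [AddCommGroup V] [Module k V] [FiniteDimensional k V]
    (Q : QuadraticForm k V)
    -- `V` is nonsingular
    (hns : ∀ v : V, (∀ w : V, polar Q v w = 0) → v = 0)
    {l : ℕ} (u x : Fin l → V) (a b : Fin l → k)
    (hu : LinearIndependent k u) (hx : LinearIndependent k x)
    (huB : ∀ i j, polar Q (u i) (u j) = 0) (hxB : ∀ i j, polar Q (x i) (x j) = 0)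
    (ha : ∀ i, a i ≠ 0) (hb : ∀ i, b i ≠ 0) :
    (List.ofFn fun i => sympTransvection Q (u i) (a i)).reverse.prod =
      (List.ofFn fun i => sympTransvection Q (x i) (b i)).reverse.prod ↔
    (Submodule.span k (Set.range u) = Submodule.span k (Set.range x) ∧
      ∃ α : Fin l → Fin l → k,
        (∀ i, u i = ∑ j, α j i • x j) ∧
        (∀ j, b j = ∑ i, a i * (α j i) ^ 2) ∧
        (∀ j m, j ≠ m → ∑ i, a i * α j i * α m i = 0)) := by
  have key : (List.ofFn fun i => sympTransvection Q (u i) (a i)).reverse.prod =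
      (List.ofFn fun i => sympTransvection Q (x i) (b i)).reverse.prod ↔
      ∀ w, ∑ i, (a i * polar Q (u i) w) • u i = ∑ j, (b j * polar Q (x j) w) • x j := by
    rw [LinearMap.ext_iff]
    simp_rw [sympTransvection_prod_apply Q u a huB, sympTransvection_prod_apply Q x b hxB,
      add_right_inj]
  rw [key]
  constructor
  · intro h
    have hle := span_le_span_of_sum_polar_eq Q hns hu ha h
    have hcoef : ∀ i, ∃ c : Fin l → k, ∑ j, c j • x j = u i := fun i =>
      (Submodule.mem_span_range_iff_exists_fun k).1
        (hle (Submodule.subset_span (Set.mem_range_self i)))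
    choose c hc using hcoef
    have hα : ∀ i, u i = ∑ j, c i j • x j := fun i => (hc i).symm
    have hgram : ∀ j m, ∑ i, a i * c i j * c i m = if m = j then b m else 0 := by
      intro j m
      obtain ⟨w, hw⟩ := exists_polar_eq_single Q hns hx j
      have hsum := h w
      rw [sum_polar_smul_eq_of_eq_sum Q a (α := fun j i => c i j) hα] at hsum
      simpa [hw] using Fintype.linearIndependent_iffₛ.1 hx _ _ hsum m
    refine ⟨le_antisymm hle (span_le_span_of_sum_polar_eq Q hns hx hb fun w => (h w).symm),
      fun j i => c i j, hα, fun j => ?_, fun j m hjm => ?_⟩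
    · have := hgram j j
      rw [if_pos rfl] at this
      rw [← this]
      exact Finset.sum_congr rfl fun i _ => by ring
    · rw [hgram, if_neg hjm.symm]
  · rintro ⟨-, α, hα, hdiag, hoff⟩ w
    rw [sum_polar_smul_eq_of_eq_sum Q a hα]
    refine Finset.sum_congr rfl fun m _ => ?_
    rw [Finset.sum_eq_single m (fun j _ hjm => by rw [hoff j m hjm, zero_mul]) (by simp), hdiag m]
    exact congrArg (fun t => (t * polar Q (x m) w) • x m)
      (Finset.sum_congr rfl fun i _ => by ring)
end

section
/- Let k = F₂(t₁, t₂) be the field of rational functions in two variables t₁, t₂ over the field with two elements. The quadratic forms q₁(x₁,x₂) = x₁² + t₂·x₂² and q₂(x₁,x₂) = (1 + t₁²t₂)·x₁² + (1 + t₂)·x₂² on k² are isometric (there is a k-linear automorphism T of k² with q₁(T(x)) = q₂(x) for all x), but there is no invertible 2×2 matrix A over k with Aᵀ·diag(1, t₂)·A = diag(1 + t₁²t₂, 1 + t₂). -/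
open Matrix

/-- The field `F₂(t₁,t₂)` of rational functions in two variables over `F₂`. -/
abbrev RatFuncTwo : Type := FractionRing (MvPolynomial (Fin 2) (ZMod 2))

/-- The variable `t₁` of `F₂(t₁,t₂)`. -/
noncomputable def tOne : RatFuncTwo :=
  algebraMap (MvPolynomial (Fin 2) (ZMod 2)) RatFuncTwo (MvPolynomial.X 0)

/-- The variable `t₂` of `F₂(t₁,t₂)`. -/
noncomputable def tTwo : RatFuncTwo :=
  algebraMap (MvPolynomial (Fin 2) (ZMod 2)) RatFuncTwo (MvPolynomial.X 1)

theorem tTwo_not_isSquare : ¬ IsSquare tTwo := by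
  rintro ⟨x, hx⟩
  obtain ⟨p, rfl⟩ := IsIntegrallyClosed.exists_algebraMap_eq_of_isIntegral_pow
    (R := MvPolynomial (Fin 2) (ZMod 2)) (x := x) two_pos (by
      rw [sq, ← hx]
      exact isIntegral_algebraMap)
  rw [tTwo, ← map_mul] at hx
  exact (MvPolynomial.X_prime (i := (1 : Fin 2)) (R := ZMod 2)).not_isSquare
    ⟨p, IsFractionRing.injective _ _ hx⟩

theorem tOne_ne_one : tOne ≠ 1 := by
  intro h
  rw [tOne, ← map_one (algebraMap (MvPolynomial (Fin 2) (ZMod 2)) RatFuncTwo)] at h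
  exact MvPolynomial.X_prime.ne_one (IsFractionRing.injective _ _ h)

theorem one_add_tOne_mul_tTwo_ne_zero : 1 + tOne * tTwo ≠ 0 := by
  intro h
  rw [tOne, tTwo, ← map_one (algebraMap (MvPolynomial (Fin 2) (ZMod 2)) RatFuncTwo), ← map_mul,
    ← map_add, ← map_zero (algebraMap (MvPolynomial (Fin 2) (ZMod 2)) RatFuncTwo)] at h
  simpa using congrArg MvPolynomial.constantCoeff (IsFractionRing.injective _ _ h)

instance RatFuncTwo.charP : CharP RatFuncTwo 2 :=
  IsFractionRing.charP_of_isFractionRing (MvPolynomial (Fin 2) (ZMod 2)) 2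

/-- If `t` is not a square, then `1` and `t` are linearly independent over the squares. -/
theorem eq_and_eq_of_sq_add_mul_sq_eq {K : Type*} [Field K] [CharP K 2] {t : K}
    (ht : ¬ IsSquare t) {a b c d : K} (h : a ^ 2 + t * b ^ 2 = c ^ 2 + t * d ^ 2) :
    a = c ∧ b = d := by
  have key : (a - c) ^ 2 = t * (b - d) ^ 2 := by
    linear_combination h + (c ^ 2 - a * c - t * b ^ 2 + t * b * d) * CharTwo.two_eq_zero (R := K)
  have hbd : b = d := by
    by_contra hne
    have hne' : b - d ≠ 0 := sub_ne_zero.mpr hne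
    refine ht ⟨(a - c) / (b - d), ?_⟩
    field_simp
    exact key.symm
  subst hbd
  refine ⟨sub_eq_zero.mp ?_, rfl⟩
  simpa using key

/-- over `k = F₂(t₁,t₂)`, the quadratic forms `q₁(x) = x₁² + t₂x₂²` and
`q₂(x) = (1+t₁²t₂)x₁² + (1+t₂)x₂²` are isometric, but the diagonal bilinear forms
`diag(1,t₂)` and `diag(1+t₁²t₂, 1+t₂)` are not congruent. -/
theorem isometric_but_not_bilinear_congruent :
    (∃ T : (Fin 2 → RatFuncTwo) ≃ₗ[RatFuncTwo] (Fin 2 → RatFuncTwo),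
      ∀ x : Fin 2 → RatFuncTwo,
        (T x 0) ^ 2 + tTwo * (T x 1) ^ 2 =
          (1 + tOne ^ 2 * tTwo) * (x 0) ^ 2 + (1 + tTwo) * (x 1) ^ 2) ∧
    ¬ (∃ A : Matrix (Fin 2) (Fin 2) RatFuncTwo, IsUnit A ∧
        Aᵀ * Matrix.diagonal ![1, tTwo] * A =
          Matrix.diagonal ![1 + tOne ^ 2 * tTwo, 1 + tTwo]) := by
  have two : (2 : RatFuncTwo) = 0 := CharTwo.two_eq_zero
  constructor
  · let M : Matrix (Fin 2) (Fin 2) RatFuncTwo := !![1, 1; tOne, 1]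
    have hM : IsUnit M.det := by
      rw [isUnit_iff_ne_zero, det_fin_two_of, one_mul, one_mul, sub_ne_zero]
      exact tOne_ne_one.symm
    refine ⟨Matrix.toLinearEquiv' M (M.invertibleOfIsUnitDet hM), fun x => ?_⟩
    have h0 : Matrix.toLinearEquiv' M (M.invertibleOfIsUnitDet hM) x 0 = x 0 + x 1 := by
      change (M *ᵥ x) 0 = _
      simp [M, mulVec, dotProduct]
    have h1 : Matrix.toLinearEquiv' M (M.invertibleOfIsUnitDet hM) x 1 = tOne * x 0 + x 1 := by
      change (M *ᵥ x) 1 = _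
      simp [M, mulVec, dotProduct]
    rw [h0, h1]
    linear_combination (x 0 * x 1 + tTwo * tOne * x 0 * x 1) * two
  · rintro ⟨A, -, hA⟩
    have entry (i j : Fin 2) := congrFun (congrFun hA i) j
    have h00 := entry 0 0
    have h01 := entry 0 1
    have h11 := entry 1 1
    simp [Matrix.mul_apply, Fin.sum_univ_two, Matrix.diagonal] at h00 h01 h11
    obtain ⟨ha, hc⟩ := eq_and_eq_of_sq_add_mul_sq_eq tTwo_not_isSquare
      (a := A 0 0) (b := A 1 0) (c := 1) (d := tOne) (by linear_combination h00)
    obtain ⟨hb, hd⟩ := eq_and_eq_of_sq_add_mul_sq_eq tTwo_not_isSquare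
      (a := A 0 1) (b := A 1 1) (c := 1) (d := 1) (by linear_combination h11)
    rw [ha, hb, hc, hd] at h01
    exact one_add_tOne_mul_tTwo_ne_zero (by linear_combination h01)
end

section
/- Let τ_U = τ_{u_l} ∘ ⋯ ∘ τ_{u_2} ∘ τ_{u_1} and τ_X = τ_{x_l} ∘ ⋯ ∘ τ_{x_2} ∘ τ_{x_1} be products of orthogonal transvections, where u₁, …, u_l and x₁, …, x_l are families of linearly independent vectors in V with B(u_i, u_j) = 0 and B(x_i, x_j) = 0 for all i ≠ j, and q(u_i) ≠ 0, q(x_i) ≠ 0 for all i. Then there exists φ ∈ O(q,k) with φ ∘ τ_U ∘ φ⁻¹ = τ_X if and only if ⟨q(u₁), …, q(u_l)⟩_B ≅ ⟨q(x₁), …, q(x_l)⟩_B. -/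
open QuadraticMap Matrix

/-- The orthogonal transvection `τ_u : w ↦ w + (B(u,w)/Q(u))·u` (for `Q u ≠ 0`). -/
noncomputable def orthTransvection {k V : Type*} [Field k] [AddCommGroup V] [Module k V]
    (Q : QuadraticForm k V) (u : V) : Module.End k V :=
  sympTransvection Q u (Q u)⁻¹

section Witt

variable {k V : Type*} [Field k] [AddCommGroup V] [Module k V]

/-- If `Q` has trivial radical, every linear functional is of the form `polar Q v`. -/
lemma exists_polar_eq_of_nonsingular [FiniteDimensional k V] {Q : QuadraticForm k V}
    (hns : ∀ v : V, (∀ w : V, polar Q v w = 0) → v = 0) (f : Module.Dual k V) :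
    ∃ v, ∀ w, polar Q v w = f w := by
  have hinj : Function.Injective (polarBilin Q) := by
    rw [injective_iff_map_eq_zero]
    exact fun v hv => hns v fun w => by simpa using LinearMap.congr_fun hv w
  have hsurj := (LinearMap.injective_iff_surjective_of_finrank_eq_finrank
    (f := polarBilin Q) Subspace.dual_finrank_eq.symm).1 hinj
  obtain ⟨v, hv⟩ := hsurj f
  exact ⟨v, fun w => by simpa using LinearMap.congr_fun hv w⟩

/-- In a nonsingular space, a vector outside a subspace `S` pairs to `1` with some vector
orthogonal to `S`. -/
lemma exists_polar_eq_one_of_notMem [FiniteDimensional k V] {Q : QuadraticForm k V}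
    (hns : ∀ v : V, (∀ w : V, polar Q v w = 0) → v = 0) {S : Submodule k V} {w : V}
    (hw : w ∉ S) : ∃ v, (∀ s ∈ S, polar Q s v = 0) ∧ polar Q w v = 1 := by
  obtain ⟨f, hf, hS⟩ := Submodule.exists_le_ker_of_notMem hw
  obtain ⟨v, hv⟩ := exists_polar_eq_of_nonsingular hns ((f w)⁻¹ • f)
  refine ⟨v, fun s hs => ?_, ?_⟩
  · have : f s = 0 := hS hs
    rw [polar_comm, hv]
    simp [this]
  · rw [polar_comm, hv]
    simp [hf]

/-- A linearly independent family in a nonsingular space has a dual family. -/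
lemma exists_dual_family_of_nonsingular [FiniteDimensional k V] {Q : QuadraticForm k V}
    (hns : ∀ v : V, (∀ w : V, polar Q v w = 0) → v = 0) {ι : Type*} [DecidableEq ι]
    {x : ι → V} (hx : LinearIndependent k x) :
    ∃ z : ι → V, ∀ i j, polar Q (x i) (z j) = if i = j then 1 else 0 := by
  have h (j : ι) : ∃ z, ∀ i, polar Q (x i) z = if i = j then 1 else 0 := by
    obtain ⟨z, hz, hz'⟩ := exists_polar_eq_one_of_notMem hns
      (linearIndependent_iff_notMem_span.1 hx j)
    refine ⟨z, fun i => ?_⟩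
    split_ifs with hij
    · rw [hij, hz']
    · exact hz _ (Submodule.subset_span ⟨i, by simpa using hij, rfl⟩)
  choose z hz using h
  exact ⟨z, fun i j => hz j i⟩

lemma polar_eq_of_isometry {Q : QuadraticForm k V} {f : Module.End k V}
    (hf : ∀ w, Q (f w) = Q w) (v w : V) : polar Q (f v) (f w) = polar Q v w := by
  simp only [polar, ← map_add, hf]

lemma injective_of_isometry {Q : QuadraticForm k V}
    (hns : ∀ v : V, (∀ w : V, polar Q v w = 0) → v = 0) {f : Module.End k V}
    (hf : ∀ w, Q (f w) = Q w) : Function.Injective f := by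
  rw [injective_iff_map_eq_zero]
  intro v hv
  refine hns v fun w => ?_
  rw [← polar_eq_of_isometry hf, hv, polar_zero_left]

/-- A product of pairwise orthogonal transvections, in closed form. -/
lemma orthTransvection_reverse_prod_apply (Q : QuadraticForm k V) {l : ℕ} (u : Fin l → V)
    (huB : ∀ i j, i ≠ j → polar Q (u i) (u j) = 0) (w : V) :
    (List.ofFn fun i => orthTransvection Q (u i)).reverse.prod w =
      w + ∑ i, ((Q (u i))⁻¹ * polar Q (u i) w) • u i := by
  induction l generalizing w with
  | zero => simp
  | succ n ih =>
    have h0 : ∀ i : Fin n, polar Q (u i.succ) (u 0) = 0 := fun i => huB _ _ (Fin.succ_ne_zero i)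
    rw [List.ofFn_succ, List.reverse_cons, List.prod_append, List.prod_singleton,
      Module.End.mul_apply, ih (fun i => u i.succ) (fun i j hij => huB _ _ (by simpa using hij)),
      Fin.sum_univ_succ]
    simp [orthTransvection, sympTransvection, polar_add_right, polar_smul_right, h0, smul_smul,
      add_assoc]

variable [CharP k 2]

lemma polar_self_eq_zero_of_charTwo (Q : QuadraticForm k V) (v : V) : polar Q v v = 0 := by
  rw [polar_self, two_nsmul, CharTwo.add_self_eq_zero]

/-- One step of Witt extension: two vectors outside `S` of equal value, pairing equally with
`S`, are related by an isometry that fixes `S` pointwise. -/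
lemma exists_isometry_fixing [FiniteDimensional k V] {Q : QuadraticForm k V}
    (hns : ∀ v : V, (∀ w : V, polar Q v w = 0) → v = 0) {S : Submodule k V} {w w' : V}
    (hw : w ∉ S) (hw' : w' ∉ S) (hq : Q w' = Q w)
    (hB : ∀ s ∈ S, polar Q s w' = polar Q s w) :
    ∃ f : Module.End k V, (∀ v, Q (f v) = Q v) ∧ (∀ s ∈ S, f s = s) ∧ f w = w' := by
  have h2 : (2 : k) = 0 := CharTwo.two_eq_zero
  obtain ⟨u, rfl⟩ : ∃ u, w' = w + u := ⟨w' - w, by abel⟩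
  have hSu : ∀ s ∈ S, polar Q s u = 0 := fun s hs => by
    simpa [polar_add_right] using hB s hs
  have hqu : Q u = polar Q w u := by
    rw [QuadraticMap.map_add Q] at hq
    linear_combination hq - polar Q w u * h2
  by_cases hu : Q u = 0
  · rw [hu] at hqu
    by_cases hwu : w ∈ S ⊔ Submodule.span k {u}
    · obtain ⟨s₀, hs₀, t, ht, rfl⟩ := Submodule.mem_sup.1 hwu
      obtain ⟨a, rfl⟩ := Submodule.mem_span_singleton.1 ht
      have huS : u ∉ S := fun h => hw (S.add_mem hs₀ (S.smul_mem a h))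
      have ha : a ≠ 0 := by
        rintro rfl
        exact hw (by simpa using hs₀)
      have ha1 : a + 1 ≠ 0 := by
        intro h
        apply hw'
        rwa [add_assoc, show a • u + u = (a + 1) • u by module, h, zero_smul, add_zero]
      obtain ⟨v, hSv, huv⟩ := exists_polar_eq_one_of_notMem hns huS
      obtain ⟨v, hSv, huv, hv⟩ : ∃ v, (∀ s ∈ S, polar Q s v = 0) ∧ polar Q u v = 1 ∧
          Q v = 0 := by
        refine ⟨v + Q v • u, fun s hs => ?_, ?_, ?_⟩
        · simp [polar_add_right, polar_smul_right, hSv s hs, hSu s hs]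
        · simp [polar_add_right, polar_smul_right, huv, h2]
        · rw [QuadraticMap.map_add Q, QuadraticMap.map_smul, polar_smul_right, polar_comm, huv, hu]
          simp only [smul_eq_mul]
          linear_combination Q v * h2
      refine ⟨LinearMap.id + a⁻¹ • (polarBilin Q v).smulRight u +
        (a + 1)⁻¹ • (polarBilin Q u).smulRight v, fun x => ?_, fun s hs => ?_, ?_⟩
      · simp only [LinearMap.add_apply, LinearMap.id_apply, LinearMap.smul_apply,
          LinearMap.smulRight_apply, polarBilin_apply_apply, QuadraticMap.map_add Q,
          QuadraticMap.map_smul, polar_add_left, polar_smul_left, polar_smul_right, hu, hv, huv,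
          polar_comm Q x u, polar_comm Q x v, smul_eq_mul]
        field_simp
        linear_combination (polar Q v x * polar Q u x * (a * (a + 1) ^ 2)) * h2
      · simp [polar_comm Q _ s, hSv s hs, hSu s hs]
      · simp [polar_add_right, polar_smul_right, polar_comm Q _ s₀, hSv s₀ hs₀, hSu s₀ hs₀,
          polar_comm Q v u, huv, ha, h2]
    · obtain ⟨v, hSv, hwv⟩ := exists_polar_eq_one_of_notMem hns hwu
      have huv : polar Q u v = 0 :=
        hSv u (Submodule.mem_sup_right (Submodule.mem_span_singleton_self u))
      refine ⟨LinearMap.id + (polarBilin Q u).smulRight v +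
        (polarBilin Q v + Q v • polarBilin Q u).smulRight u, fun x => ?_, fun s hs => ?_, ?_⟩
      · simp only [LinearMap.add_apply, LinearMap.id_apply, LinearMap.smul_apply,
          LinearMap.smulRight_apply, polarBilin_apply_apply, QuadraticMap.map_add Q,
          QuadraticMap.map_smul, polar_add_left, polar_smul_left, polar_smul_right, hu,
          polar_comm Q v u, huv, polar_comm Q x u, polar_comm Q x v, smul_eq_mul]
        linear_combination (polar Q v x * polar Q u x + polar Q u x ^ 2 * Q v) * h2
      · simp [polar_comm Q _ s, hSv s (Submodule.mem_sup_left hs), hSu s hs]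
      · simp [polar_comm Q _ w, hwv, ← hqu]
  · refine ⟨LinearMap.id + (Q u)⁻¹ • (polarBilin Q u).smulRight u, fun x => ?_,
      fun s hs => ?_, ?_⟩
    · simp only [LinearMap.add_apply, LinearMap.id_apply, LinearMap.smul_apply,
        LinearMap.smulRight_apply, polarBilin_apply_apply, QuadraticMap.map_add Q,
        QuadraticMap.map_smul, polar_smul_right, polar_comm Q x u, smul_eq_mul]
      field_simp
      linear_combination (polar Q u x ^ 2) * h2
    · simp [polar_comm Q _ s, hSu s hs]
    · simp [polar_comm Q _ w, ← hqu, hu]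

/-- Witt's extension theorem for nonsingular quadratic forms in characteristic two. -/
theorem exists_isometry_extending [FiniteDimensional k V] {Q : QuadraticForm k V}
    (hns : ∀ v : V, (∀ w : V, polar Q v w = 0) → v = 0) {n : ℕ} {u y : Fin n → V}
    (hu : LinearIndependent k u) (hy : LinearIndependent k y)
    (hq : ∀ i, Q (y i) = Q (u i))
    (hB : ∀ i j, polar Q (y i) (y j) = polar Q (u i) (u j)) :
    ∃ f : Module.End k V, (∀ v, Q (f v) = Q v) ∧ ∀ i, f (u i) = y i := by
  induction n with
  | zero => exact ⟨LinearMap.id, fun _ => rfl, fun i => i.elim0⟩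
  | succ n ih =>
    obtain ⟨f, hf, hfu⟩ := ih (u := fun i => u i.succ) (y := fun i => y i.succ)
      (hu.comp _ (Fin.succ_injective n)) (hy.comp _ (Fin.succ_injective n))
      (fun i => hq _) (fun i j => hB _ _)
    have hrange (z : Fin (n + 1) → V) :
        Set.range (fun i : Fin n => z i.succ) = z '' {0}ᶜ := by
      rw [← Fin.range_succ, ← Set.range_comp]
      rfl
    have hnotMem {z : Fin (n + 1) → V} (hz : LinearIndependent k z) :
        z 0 ∉ Submodule.span k (Set.range fun i : Fin n => z i.succ) := by
      rw [hrange, Set.compl_eq_univ_sdiff]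
      exact linearIndependent_iff_notMem_span.1 hz 0
    have hfu0 : f (u 0) ∉ Submodule.span k (Set.range fun i : Fin n => y i.succ) := by
      have := hnotMem (hu.map' f (LinearMap.ker_eq_bot.2 (injective_of_isometry hns hf)))
      simpa [hfu] using this
    obtain ⟨g, hg, hgS, hgw⟩ := exists_isometry_fixing hns hfu0 (hnotMem hy)
      ((hq 0).trans (hf _).symm) (fun s hs => by
        induction hs using Submodule.span_induction with
        | mem s hs =>
          obtain ⟨i, rfl⟩ := hs
          simp only
          rw [hB, ← hfu i, polar_eq_of_isometry hf]
        | zero => simp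
        | add a b _ _ ha hb => rw [polar_add_left, polar_add_left, ha, hb]
        | smul c a _ ha => rw [polar_smul_left, polar_smul_left, ha])
    refine ⟨g ∘ₗ f, fun v => by simp [hg, hf], Fin.cases (by simpa using hgw) fun i => ?_⟩
    rw [LinearMap.comp_apply, hfu]
    exact hgS _ (Submodule.subset_span ⟨i, rfl⟩)

end Witt

/-- two orthogonal diagonal involutions `τ_U = τ_{u_l}∘⋯∘τ_{u_1}` and
`τ_X = τ_{x_l}∘⋯∘τ_{x_1}` are `O(q,k)`-conjugate iff the diagonal bilinear forms
`⟨Q(u₁),…,Q(u_l)⟩_B` and `⟨Q(x₁),…,Q(x_l)⟩_B` are congruent. -/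
theorem orthTransvection_products_conjugate_iff
    {k V : Type*} [Field k] [CharP k 2] [AddCommGroup V] [Module k V] [FiniteDimensional k V]
    (Q : QuadraticForm k V)
    -- `V` is nonsingular
    (hns : ∀ v : V, (∀ w : V, polar Q v w = 0) → v = 0)
    {l : ℕ} (u x : Fin l → V)
    (hu : LinearIndependent k u) (hx : LinearIndependent k x)
    (huB : ∀ i j, i ≠ j → polar Q (u i) (u j) = 0)
    (hxB : ∀ i j, i ≠ j → polar Q (x i) (x j) = 0)
    (huq : ∀ i, Q (u i) ≠ 0) (hxq : ∀ i, Q (x i) ≠ 0) :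
    (∃ φ : V ≃ₗ[k] V, (∀ w : V, Q (φ w) = Q w) ∧
      φ.toLinearMap ∘ₗ (List.ofFn fun i => orthTransvection Q (u i)).reverse.prod ∘ₗ
          φ.symm.toLinearMap =
        (List.ofFn fun i => orthTransvection Q (x i)).reverse.prod) ↔
    (∃ A : Matrix (Fin l) (Fin l) k, IsUnit A ∧
      Aᵀ * Matrix.diagonal (fun i => Q (u i)) * A = Matrix.diagonal (fun i => Q (x i))) := by
  have hP (φ : V ≃ₗ[k] V) (hφ : ∀ w, Q (φ w) = Q w) (w : V) :
      (φ.toLinearMap ∘ₗ (List.ofFn fun i => orthTransvection Q (u i)).reverse.prod ∘ₗ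
          φ.symm.toLinearMap) w =
        w + ∑ i, ((Q (u i))⁻¹ * polar Q (φ (u i)) w) • φ (u i) := by
    have (i : Fin l) : polar Q (u i) (φ.symm w) = polar Q (φ (u i)) w := by
      simpa using (polar_eq_of_isometry (f := φ.toLinearMap) hφ (u i) (φ.symm w)).symm
    simp [orthTransvection_reverse_prod_apply Q u huB, this]
  constructor
  · rintro ⟨φ, hφ, h⟩
    obtain ⟨z, hz⟩ := exists_dual_family_of_nonsingular hns hx
    have hN (w : V) : ∑ i, ((Q (u i))⁻¹ * polar Q (φ (u i)) w) • φ (u i) =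
        ∑ i, ((Q (x i))⁻¹ * polar Q (x i) w) • x i := by
      have := LinearMap.congr_fun h w
      rwa [hP φ hφ, orthTransvection_reverse_prod_apply Q x hxB, add_right_inj] at this
    let A : Matrix (Fin l) (Fin l) k :=
      Matrix.of fun i m => (Q (u i))⁻¹ * polar Q (φ (u i)) (z m) * Q (x m)
    have hA : Aᵀ * Matrix.diagonal (fun i => Q (u i)) * A =
        Matrix.diagonal (fun i => Q (x i)) := by
      ext m n
      have h1 := congrArg (fun v => polarBilin Q v (z n)) (hN (z m))
      simp only [map_sum, map_smul, LinearMap.sum_apply, LinearMap.smul_apply,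
        polarBilin_apply_apply, hz, smul_eq_mul, mul_ite, mul_one, mul_zero,
        Finset.sum_ite_eq', Finset.mem_univ, if_true] at h1
      rw [Matrix.mul_apply, Matrix.diagonal_apply]
      calc _ = Q (x m) * Q (x n) * ∑ i, (Q (u i))⁻¹ * polar Q (φ (u i)) (z m) *
            polar Q (φ (u i)) (z n) := by
            rw [Finset.mul_sum]
            refine Finset.sum_congr rfl fun i _ => ?_
            simp only [Matrix.mul_diagonal, Matrix.transpose_apply, A, Matrix.of_apply]
            have := huq i
            field_simp
        _ = _ := by
            rw [h1]
            have := hxq m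
            rcases eq_or_ne m n with rfl | hmn
            · simp [this]
            · simp [hmn, hmn.symm]
    refine ⟨A, ?_, hA⟩
    rw [Matrix.isUnit_iff_isUnit_det, isUnit_iff_ne_zero]
    intro h0
    have := congrArg Matrix.det hA
    rw [Matrix.det_mul, h0, mul_zero, Matrix.det_diagonal] at this
    exact Finset.prod_ne_zero_iff.2 (fun i _ => hxq i) this.symm
  · rintro ⟨A, hA, h⟩
    obtain ⟨P, hAP, -⟩ := isUnit_iff_exists.1 hA
    have hPQ : Pᵀ * Matrix.diagonal (fun i => Q (x i)) * P =
        Matrix.diagonal (fun i => Q (u i)) := by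
      have hPA' : Pᵀ * Aᵀ = 1 := by rw [← Matrix.transpose_mul, hAP, Matrix.transpose_one]
      rw [← h]
      calc _ = (Pᵀ * Aᵀ) * Matrix.diagonal (fun i => Q (u i)) * (A * P) := by
            simp only [Matrix.mul_assoc]
        _ = _ := by rw [hPA', hAP, Matrix.one_mul, Matrix.mul_one]
    have hinv (c : Fin l → k) (hc : ∀ i, c i ≠ 0) :
        Matrix.diagonal c * Matrix.diagonal (fun i => (c i)⁻¹) = 1 := by
      rw [Matrix.diagonal_mul_diagonal, ← Matrix.diagonal_one]
      congr 1
      ext i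
      exact mul_inv_cancel₀ (hc i)
    have hPinv : P * Matrix.diagonal (fun i => (Q (u i))⁻¹) * Pᵀ =
        Matrix.diagonal (fun i => (Q (x i))⁻¹) := by
      have h1 : (Pᵀ * Matrix.diagonal (fun i => Q (x i))) *
          (P * Matrix.diagonal (fun i => (Q (u i))⁻¹)) = 1 := by
        rw [← Matrix.mul_assoc, hPQ, hinv _ huq]
      have h2 := mul_eq_one_comm.1 h1
      rw [← Matrix.mul_assoc] at h2
      calc _ = P * Matrix.diagonal (fun i => (Q (u i))⁻¹) * Pᵀ *
            (Matrix.diagonal (fun i => Q (x i)) * Matrix.diagonal (fun i => (Q (x i))⁻¹)) := by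
            rw [hinv _ hxq, Matrix.mul_one]
        _ = _ := by rw [← Matrix.mul_assoc, h2, Matrix.one_mul]
    have hxB' (i j : Fin l) : polar Q (x i) (x j) = 0 := by
      rcases eq_or_ne i j with rfl | hij
      · exact polar_self_eq_zero_of_charTwo Q _
      · exact hxB i j hij
    have huB' (i j : Fin l) : polar Q (u i) (u j) = 0 := by
      rcases eq_or_ne i j with rfl | hij
      · exact polar_self_eq_zero_of_charTwo Q _
      · exact huB i j hij
    let y : Fin l → V := fun i => ∑ j, P j i • x j
    have hy : LinearIndependent k y := by
      rw [Fintype.linearIndependent_iff]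
      intro g hg
      have h0 : P *ᵥ g = 0 := by
        ext j
        refine Fintype.linearIndependent_iff.1 hx (P *ᵥ g) ?_ j
        rw [← hg]
        simp only [y, Finset.smul_sum, Matrix.mulVec, dotProduct, Finset.sum_smul]
        rw [Finset.sum_comm]
        simp [smul_smul, mul_comm]
      have : g = 0 := by
        rw [← Matrix.one_mulVec g, ← hAP, ← Matrix.mulVec_mulVec, h0, Matrix.mulVec_zero]
      simp [this]
    have hyB (i j : Fin l) : polar Q (y i) (y j) = 0 := by
      rw [← polarBilin_apply_apply]
      simp [y, map_sum, LinearMap.sum_apply, hxB']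
    have hyq (i : Fin l) : Q (y i) = Q (u i) := by
      have hsum (s : Finset (Fin l)) :
          Q (∑ j ∈ s, P j i • x j) = ∑ j ∈ s, P j i * Q (x j) * P j i := by
        induction s using Finset.induction_on with
        | empty => simp
        | insert a s ha ih =>
          have : polar Q (P a i • x a) (∑ j ∈ s, P j i • x j) = 0 := by
            rw [← polarBilin_apply_apply]
            simp [map_sum, hxB']
          rw [Finset.sum_insert ha, Finset.sum_insert ha, QuadraticMap.map_add Q, ih, this,
            QuadraticMap.map_smul, smul_eq_mul]
          ring
      have := congrFun (congrFun hPQ i) i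
      rw [Matrix.mul_apply, Matrix.diagonal_apply_eq] at this
      simp only [Matrix.mul_diagonal, Matrix.transpose_apply] at this
      rw [← this]
      exact hsum Finset.univ
    obtain ⟨f, hf, hfu⟩ := exists_isometry_extending hns hu hy hyq
      (fun i j => by rw [hyB, huB'])
    let φ := LinearEquiv.ofInjectiveEndo f (injective_of_isometry hns hf)
    have hφ (w : V) : φ w = f w := rfl
    have hφQ (w : V) : Q (φ w) = Q w := by rw [hφ, hf]
    refine ⟨φ, hφQ, LinearMap.ext fun w => ?_⟩
    rw [hP φ hφQ, orthTransvection_reverse_prod_apply Q x hxB, add_right_inj]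
    have hcoef (m j : Fin l) : ∑ i, P m i * (Q (u i))⁻¹ * P j i =
        if m = j then (Q (x m))⁻¹ else 0 := by
      have := congrFun (congrFun hPinv m) j
      rw [Matrix.mul_apply, Matrix.diagonal_apply] at this
      simpa only [Matrix.mul_diagonal, Matrix.transpose_apply] using this
    have hyw (i : Fin l) : polar Q (y i) w = ∑ j, P j i * polar Q (x j) w := by
      rw [← polarBilin_apply_apply]
      simp [y, map_sum, LinearMap.sum_apply]
    calc _ = ∑ i, ∑ m, ∑ j, (P m i * (Q (u i))⁻¹ * P j i * polar Q (x j) w) • x m := by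
          refine Finset.sum_congr rfl fun i _ => ?_
          rw [hφ, hfu, hyw]
          simp only [y, Finset.smul_sum, smul_smul, Finset.mul_sum, Finset.sum_mul,
            Finset.sum_smul]
          refine Finset.sum_congr rfl fun m _ => Finset.sum_congr rfl fun j _ => ?_
          congr 1
          ring
      _ = ∑ m, ∑ j, ((∑ i, P m i * (Q (u i))⁻¹ * P j i) * polar Q (x j) w) • x m := by
          rw [Finset.sum_comm]
          refine Finset.sum_congr rfl fun m _ => ?_
          rw [Finset.sum_comm]
          simp only [Finset.sum_mul, Finset.sum_smul]
      _ = _ := by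
          simp only [hcoef, ite_mul, zero_mul, ite_smul, zero_smul, Finset.sum_ite_eq,
            Finset.mem_univ, if_true]
end

section
/- Let η = η_m ∘ ⋯ ∘ η_2 ∘ η_1 and μ = μ_n ∘ ⋯ ∘ μ_2 ∘ μ_1 be null involutions in O(q,k), where η₁, …, η_m are basic null involutions supported on pairwise orthogonal 4-dimensional subspaces N₁, …, N_m of V, and μ₁, …, μ_n are basic null involutions supported on pairwise orthogonal 4-dimensional subspaces M₁, …, M_n of V. Then η and μ are O(q,k)-conjugate if and only if m = n. -/
open QuadraticMap

/-- `η` is a basic null involution supported on the 4-dimensional subspace `P`: `P` is the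
orthogonal sum of two hyperbolic planes with basis `e₁, f₂, e₂, f₁`, `η ∈ O(q,k)` fixes
`e₁, e₂`, sends `f₁ ↦ e₂ + f₁`, `f₂ ↦ e₁ + f₂`, and is the identity on the orthogonal
complement of `P`. -/
def IsBasicNullOn {k V : Type*} [Field k] [AddCommGroup V] [Module k V]
    (Q : QuadraticForm k V) (η : Module.End k V) (P : Submodule k V) : Prop :=
  Function.Bijective η ∧ (∀ w : V, Q (η w) = Q w) ∧
  ∃ e₁ f₂ e₂ f₁ : V,
    LinearIndependent k ![e₁, f₂, e₂, f₁] ∧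
    P = Submodule.span k {e₁, f₂, e₂, f₁} ∧
    Q e₁ = 0 ∧ Q e₂ = 0 ∧ Q f₁ = 0 ∧ Q f₂ = 0 ∧
    polar Q e₁ f₁ = 1 ∧ polar Q e₂ f₂ = 1 ∧
    polar Q e₁ e₂ = 0 ∧ polar Q e₁ f₂ = 0 ∧ polar Q e₂ f₁ = 0 ∧ polar Q f₁ f₂ = 0 ∧
    η e₁ = e₁ ∧ η e₂ = e₂ ∧ η f₁ = e₂ + f₁ ∧ η f₂ = e₁ + f₂ ∧
    (∀ v : V, (∀ p ∈ P, polar Q v p = 0) → η v = v)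

namespace QuadraticForm

variable {k V : Type*} [Field k] [AddCommGroup V] [Module k V] {Q : QuadraticForm k V}

theorem polar_isometryEquiv (φ : Q.IsometryEquiv Q) (v w : V) :
    polar Q (φ v) (φ w) = polar Q v w := by
  simp only [polar, ← map_add, φ.map_app]

/-- The orthogonal reflection in an anisotropic vector. -/
theorem exists_reflection (u : V) (hu : Q u ≠ 0) :
    ∃ φ : Q.IsometryEquiv Q, ∀ v, φ v = v - (polar Q u v / Q u) • u := by
  have h : ((Q u)⁻¹ • Q.polarBilin u) u = 2 := by
    simp [polar_self]
    field_simp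
  refine ⟨⟨Module.reflection h, fun v ↦ ?_⟩, fun v ↦ ?_⟩
  · change Q (Module.reflection h v) = Q v
    rw [Module.reflection_apply, sub_eq_add_neg, QuadraticMap.map_add Q, ← neg_smul, Q.map_smul,
      polar_smul_right, polar_comm Q v u]
    simp
    field_simp
    ring
  · change Module.reflection h v = _
    rw [Module.reflection_apply]
    simp [div_eq_inv_mul]

/-- The Eichler (Siegel) transformation attached to an isotropic vector `e` and `u ∈ e^⊥`,
as a linear map. -/
def eichlerMap (Q : QuadraticForm k V) (e u : V) : V →ₗ[k] V :=
  LinearMap.id + (Q.polarBilin e).smulRight u - (Q.polarBilin u).smulRight e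
    - (Q u • Q.polarBilin e).smulRight e

theorem eichlerMap_apply (e u v : V) : eichlerMap Q e u v =
    v + polar Q e v • u - polar Q u v • e - (Q u * polar Q e v) • e := by
  simp [eichlerMap]

theorem eichlerMap_neg_comp {e u : V} (he : Q e = 0) (heu : polar Q e u = 0) :
    eichlerMap Q e u ∘ₗ eichlerMap Q e (-u) = LinearMap.id := by
  ext v
  have hee : polar Q e e = 0 := by simp [polar_self, he]
  have hue : polar Q u e = 0 := by rw [polar_comm, heu]
  simp only [LinearMap.comp_apply, eichlerMap_apply, polar_add_right, polar_sub_right,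
    polar_smul_right, polar_neg_right, polar_neg_left, hee, hue, heu, polar_self, Q.map_neg,
    LinearMap.id_apply, smul_eq_mul]
  module

theorem exists_eichler {e u : V} (he : Q e = 0) (heu : polar Q e u = 0) :
    ∃ φ : Q.IsometryEquiv Q, ∀ v, φ v =
      v + polar Q e v • u - polar Q u v • e - (Q u * polar Q e v) • e := by
  refine ⟨⟨LinearEquiv.ofLinearMap (eichlerMap Q e u) (eichlerMap Q e (-u))
    (eichlerMap_neg_comp he heu) ?_, fun v ↦ ?_⟩, fun v ↦ eichlerMap_apply e u v⟩
  · simpa using eichlerMap_neg_comp (u := -u) he (by simp [heu])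
  · change Q (eichlerMap Q e u v) = Q v
    rw [eichlerMap_apply]
    have hue : polar Q u e = 0 := by rw [polar_comm, heu]
    simp only [sub_eq_add_neg, ← neg_smul, QuadraticMap.map_add Q, Q.map_smul, polar_add_left,
      polar_smul_left, polar_smul_right, he, hue, polar_comm Q v u, polar_comm Q v e, smul_eq_mul,
      polar_self]
    ring

/-- A hyperbolic family: pairs `(E i, F i)` spanning pairwise orthogonal hyperbolic planes. -/
structure IsHyperbolicFamily {ι : Type*} (Q : QuadraticForm k V) (E F : ι → V) : Prop where
  left : ∀ i, Q (E i) = 0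
  right : ∀ i, Q (F i) = 0
  left_left : ∀ i j, polar Q (E i) (E j) = 0
  right_right : ∀ i j, polar Q (F i) (F j) = 0
  left_right : ∀ i, polar Q (E i) (F i) = 1
  left_right_ne : ∀ i j, i ≠ j → polar Q (E i) (F j) = 0

theorem exists_isometryEquiv_of_polar_ne_zero {e e' : V} (he : Q e = 0) (he' : Q e' = 0)
    (h : polar Q e e' ≠ 0) :
    ∃ φ : Q.IsometryEquiv Q, φ e = e' ∧
      ∀ v, polar Q v e = 0 → polar Q v e' = 0 → φ v = v := by
  have hq : Q (e - e') = -polar Q e e' := by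
    simp [sub_eq_add_neg, QuadraticMap.map_add Q, he, he']
  obtain ⟨φ, hφ⟩ := exists_reflection (Q := Q) (e - e') (by simpa [hq] using h)
  refine ⟨φ, ?_, fun v h₁ h₂ ↦ ?_⟩
  · have h1 : polar Q (e - e') e = -polar Q e e' := by
      simp [polar_sub_left, polar_self, he, polar_comm Q e' e]
    rw [hφ, hq, h1, div_self (neg_ne_zero.mpr h)]
    simp
  · simp [hφ, polar_comm Q _ v, h₁, h₂]

/-- Any two isotropic vectors `e, e'` with hyperbolic partners `f, f'` are related by an isometry
supported on the span of `e, f, e', f'`. -/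
theorem exists_isometryEquiv_of_isotropic {e f e' f' : V} (he : Q e = 0) (hf : Q f = 0)
    (he' : Q e' = 0) (hf' : Q f' = 0) (hef : polar Q e f = 1) (hef' : polar Q e' f' = 1) :
    ∃ φ : Q.IsometryEquiv Q, φ e = e' ∧ ∀ v, polar Q v e = 0 → polar Q v f = 0 →
      polar Q v e' = 0 → polar Q v f' = 0 → φ v = v := by
  by_cases h : polar Q e e' = 0
  · obtain ⟨x, hx, hex, hxe', hxv⟩ : ∃ x, Q x = 0 ∧ polar Q e x ≠ 0 ∧ polar Q x e' ≠ 0 ∧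
        ∀ v, polar Q v e = 0 → polar Q v f = 0 → polar Q v e' = 0 → polar Q v f' = 0 →
          polar Q v x = 0 := by
      by_cases h₁ : polar Q f e' = 0
      · by_cases h₂ : polar Q e f' = 0
        · refine ⟨f + f' - polar Q f f' • e, ?_, ?_, ?_, fun v a b c d ↦ ?_⟩
          · simp [sub_eq_add_neg, QuadraticMap.map_add Q, Q.map_smul, ← neg_smul, hf, hf', he,
              polar_comm Q _ e, hef, h₂]
          · simp [polar_sub_right, polar_add_right, polar_self, he, hef, h₂]
          · simp [polar_sub_left, polar_add_left, h, h₁, polar_comm Q f' e', hef']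
          · simp [polar_sub_right, polar_add_right, a, b, d]
        · exact ⟨f', hf', h₂, by simp [polar_comm Q f' e', hef'], fun _ _ _ _ d ↦ d⟩
      · exact ⟨f, hf, by simp [hef], h₁, fun _ _ b _ _ ↦ b⟩
    obtain ⟨φ, hφ, hφv⟩ := exists_isometryEquiv_of_polar_ne_zero he hx hex
    obtain ⟨ψ, hψ, hψv⟩ := exists_isometryEquiv_of_polar_ne_zero hx he' hxe'
    refine ⟨φ.trans ψ, ?_, fun v a b c d ↦ ?_⟩
    · change ψ (φ e) = e'
      rw [hφ, hψ]
    · change ψ (φ v) = v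
      have hvx := hxv v a b c d
      rw [hφv v a hvx, hψv v hvx c]
  · obtain ⟨φ, hφ, hφv⟩ := exists_isometryEquiv_of_polar_ne_zero he he' h
    exact ⟨φ, hφ, fun v a _ c _ ↦ hφv v a c⟩

/-- Any two hyperbolic pairs are related by an isometry supported on their common span. -/
theorem exists_isometryEquiv_of_hyperbolicPair {e f e' f' : V} (he : Q e = 0) (hf : Q f = 0)
    (he' : Q e' = 0) (hf' : Q f' = 0) (hef : polar Q e f = 1) (hef' : polar Q e' f' = 1) :
    ∃ φ : Q.IsometryEquiv Q, φ e = e' ∧ φ f = f' ∧ ∀ v, polar Q v e = 0 → polar Q v f = 0 →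
      polar Q v e' = 0 → polar Q v f' = 0 → φ v = v := by
  obtain ⟨φ, hφ, hφv⟩ := exists_isometryEquiv_of_isotropic he hf he' hf' hef hef'
  have h₁ : polar Q e' (φ f) = 1 := by rw [← hφ, polar_isometryEquiv, hef]
  have hqf : Q (φ f) = 0 := by rw [φ.map_app, hf]
  have hu : polar Q e' (f' - φ f) = 0 := by simp [polar_sub_right, h₁, hef']
  obtain ⟨ψ, hψ⟩ := exists_eichler he' hu
  refine ⟨φ.trans ψ, ?_, ?_, fun v a b c d ↦ ?_⟩
  · change ψ (φ e) = e'
    rw [hφ, hψ]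
    simp [polar_self, he', polar_comm Q _ e', hu]
  · change ψ (φ f) = f'
    rw [hψ, h₁]
    simp only [sub_eq_add_neg, QuadraticMap.map_add Q, polar_add_left, polar_neg_left,
      polar_neg_right, polar_self, hqf, hf', Q.map_neg]
    module
  · change ψ (φ v) = v
    have h₂ : polar Q v (φ f) = 0 := by
      conv_lhs => rw [← hφv v a b c d]
      rw [polar_isometryEquiv, b]
    rw [hφv v a b c d, hψ]
    simp [polar_comm Q _ v, c, d, h₂]

/-- Witt's extension theorem for hyperbolic families. -/
theorem IsHyperbolicFamily.exists_isometryEquiv {ι : Type*} [Finite ι] {E F E' F' : ι → V}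
    (h : IsHyperbolicFamily Q E F) (h' : IsHyperbolicFamily Q E' F') :
    ∃ φ : Q.IsometryEquiv Q, (∀ i, φ (E i) = E' i) ∧ ∀ i, φ (F i) = F' i := by
  classical
  cases nonempty_fintype ι
  suffices H : ∀ s : Finset ι, ∃ φ : Q.IsometryEquiv Q,
      ∀ i ∈ s, φ (E i) = E' i ∧ φ (F i) = F' i by
    obtain ⟨φ, hφ⟩ := H Finset.univ
    exact ⟨φ, fun i ↦ (hφ i (Finset.mem_univ i)).1, fun i ↦ (hφ i (Finset.mem_univ i)).2⟩
  intro s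
  induction s using Finset.induction_on with
  | empty => exact ⟨QuadraticMap.IsometryEquiv.refl Q, by simp⟩
  | insert j s hj ih =>
    obtain ⟨φ, hφ⟩ := ih
    obtain ⟨ψ, hψE, hψF, hψ⟩ := exists_isometryEquiv_of_hyperbolicPair (Q := Q)
      (e := φ (E j)) (f := φ (F j)) (e' := E' j) (f' := F' j)
      (by rw [φ.map_app, h.left]) (by rw [φ.map_app, h.right]) (h'.left j) (h'.right j)
      (by rw [polar_isometryEquiv, h.left_right]) (h'.left_right j)
    refine ⟨φ.trans ψ, fun i hi ↦ ?_⟩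
    change ψ (φ (E i)) = E' i ∧ ψ (φ (F i)) = F' i
    rcases Finset.mem_insert.mp hi with rfl | hi
    · exact ⟨hψE, hψF⟩
    have hij : i ≠ j := fun hij ↦ hj (hij ▸ hi)
    obtain ⟨h₁, h₂⟩ := hφ i hi
    constructor
    · rw [hψ, h₁]
      · rw [polar_isometryEquiv, h.left_left]
      · rw [polar_isometryEquiv, h.left_right_ne i j hij]
      · rw [h₁, h'.left_left]
      · rw [h₁, h'.left_right_ne i j hij]
    · rw [hψ, h₂]
      · rw [polar_isometryEquiv, polar_comm, h.left_right_ne j i hij.symm]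
      · rw [polar_isometryEquiv, h.right_right]
      · rw [h₂, polar_comm, h'.left_right_ne j i hij.symm]
      · rw [h₂, h'.right_right]

theorem IsHyperbolicFamily.linearIndependent_left {ι : Type*} {E F : ι → V}
    (h : IsHyperbolicFamily Q E F) : LinearIndependent k E := by
  rw [linearIndependent_iff']
  intro s g hg i hi
  have := congrArg (Q.polarBilin (F i)) hg
  rw [map_sum, Finset.sum_eq_single i] at this
  · simpa [polar_comm Q (F i), h.left_right] using this
  · intro j _ hji
    simp [polar_comm Q (F i), h.left_right_ne j i hji]
  · exact fun hi' ↦ absurd hi hi'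

theorem IsHyperbolicFamily.range_eq_span {m : ℕ} {E F : Fin m × Bool → V}
    (h : IsHyperbolicFamily Q E F) (g : Module.End k V)
    (hg : ∀ v, g v = v + ∑ p, polar Q v (E p) • E (p.1, !p.2)) :
    LinearMap.range (g - 1) = Submodule.span k (Set.range E) := by
  have hg' : ∀ v, (g - 1) v = ∑ p, polar Q v (E p) • E (p.1, !p.2) := by
    intro v
    simp [hg]
  apply le_antisymm
  · rintro _ ⟨v, rfl⟩
    rw [hg']
    exact Submodule.sum_mem _ fun p _ ↦
      Submodule.smul_mem _ _ (Submodule.subset_span (Set.mem_range_self _))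
  · rw [Submodule.span_le]
    rintro _ ⟨⟨i, b⟩, rfl⟩
    refine ⟨F (i, !b), ?_⟩
    rw [hg', Finset.sum_eq_single (i, !b)]
    · simp [polar_comm Q (F (i, !b)), h.left_right]
    · intro j _ hj
      rw [polar_comm, h.left_right_ne _ _ hj, zero_smul]
    · simp

theorem IsHyperbolicFamily.finrank_range {m : ℕ} {E F : Fin m × Bool → V}
    (h : IsHyperbolicFamily Q E F) (g : Module.End k V)
    (hg : ∀ v, g v = v + ∑ p, polar Q v (E p) • E (p.1, !p.2)) :
    Module.finrank k (LinearMap.range (g - 1)) = m * 2 := by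
  rw [h.range_eq_span g hg, finrank_span_eq_card h.linearIndependent_left]
  simp

end QuadraticForm

open QuadraticForm

section NullInvolution

variable {k V : Type*} [Field k] [AddCommGroup V] [Module k V] {Q : QuadraticForm k V}

theorem IsBasicNullOn.exists_isHyperbolicFamily {η : Module.End k V} {P : Submodule k V}
    (h : IsBasicNullOn Q η P) :
    ∃ E F : Bool → V, IsHyperbolicFamily Q E F ∧ (∀ b, E b ∈ P) ∧ (∀ b, F b ∈ P) ∧
      ∀ v, η v = v + ∑ b, polar Q v (E b) • E (!b) := by
  obtain ⟨-, -, e₁, f₂, e₂, f₁, -, rfl, q1, q2, q3, q4, p11, p22, pe, p12, p21, pf,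
    h1, h2, h3, h4, h5⟩ := h
  have pe' := polar_comm Q e₁ e₂ ▸ pe
  have pf' := polar_comm Q f₁ f₂ ▸ pf
  have p12' := polar_comm Q e₁ f₂ ▸ p12
  have p21' := polar_comm Q e₂ f₁ ▸ p21
  have p11' := polar_comm Q e₁ f₁ ▸ p11
  have p22' := polar_comm Q e₂ f₂ ▸ p22
  refine ⟨fun b ↦ cond b e₁ e₂, fun b ↦ cond b f₁ f₂, ?_, ?_, ?_, fun v ↦ ?_⟩
  · constructor <;> simp [Bool.forall_bool, polar_self, *]
  · rintro (_ | _) <;> exact Submodule.subset_span (by simp)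
  · rintro (_ | _) <;> exact Submodule.subset_span (by simp)
  · have key := h5 (v - polar Q v f₁ • e₁ - polar Q v e₁ • f₁ - polar Q v f₂ • e₂
      - polar Q v e₂ • f₂) ?_
    · simp only [map_sub, map_smul, h1, h2, h3, h4] at key
      simp only [Fintype.sum_bool, cond_true, cond_false, Bool.not_true, Bool.not_false]
      rw [← sub_eq_zero] at key ⊢
      rw [← key]
      module
    · intro p hp
      induction hp using Submodule.span_induction with
      | mem x hx =>
        simp only [Set.mem_insert_iff, Set.mem_singleton_iff] at hx
        rcases hx with rfl | rfl | rfl | rfl <;>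
        simp [polar_sub_left, polar_self, *]
      | zero => simp
      | add x y _ _ hx hy => rw [polar_add_right, hx, hy, add_zero]
      | smul a x _ hx => rw [polar_smul_right, hx, smul_zero]

theorem reverse_prod_ofFn_apply {m : ℕ} (ηs : Fin m → Module.End k V) (E : Fin m → Bool → V)
    (horth : ∀ i j, i ≠ j → ∀ b c, polar Q (E i b) (E j c) = 0)
    (hη : ∀ i v, ηs i v = v + ∑ b, polar Q v (E i b) • E i (!b)) (v : V) :
    (List.ofFn ηs).reverse.prod v = v + ∑ i, ∑ b, polar Q v (E i b) • E i (!b) := by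
  induction m generalizing v with
  | zero => simp
  | succ m ih =>
    rw [List.ofFn_succ, List.reverse_cons, List.prod_append, List.prod_singleton,
      Module.End.mul_apply, ih (fun i ↦ ηs i.succ) (fun i ↦ E i.succ)
        (fun i j hij ↦ horth _ _ (by simpa using hij)) (fun i ↦ hη _), Fin.sum_univ_succ, ← add_assoc,
      hη 0]
    congr 1
    refine Finset.sum_congr rfl fun i _ ↦ Finset.sum_congr rfl fun b _ ↦ ?_
    simp [polar_add_left, horth 0 i.succ (Fin.succ_ne_zero i).symm]

theorem exists_isHyperbolicFamily_reverse_prod {m : ℕ} {ηs : Fin m → Module.End k V}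
    {N : Fin m → Submodule k V} (hη : ∀ i, IsBasicNullOn Q (ηs i) (N i))
    (hN : ∀ i j, i ≠ j → ∀ v ∈ N i, ∀ w ∈ N j, polar Q v w = 0) :
    ∃ E F : Fin m × Bool → V, IsHyperbolicFamily Q E F ∧
      ∀ v, (List.ofFn ηs).reverse.prod v = v + ∑ p, polar Q v (E p) • E (p.1, !p.2) := by
  choose E F h hE hF hv using fun i ↦ (hη i).exists_isHyperbolicFamily
  refine ⟨fun p ↦ E p.1 p.2, fun p ↦ F p.1 p.2,
    ⟨fun p ↦ (h _).left _, fun p ↦ (h _).right _, ?_, ?_, fun p ↦ (h _).left_right _, ?_⟩,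
    fun v ↦ ?_⟩
  · rintro ⟨i, b⟩ ⟨j, c⟩
    by_cases hij : i = j
    · subst hij
      exact (h i).left_left b c
    · exact hN i j hij _ (hE i b) _ (hE j c)
  · rintro ⟨i, b⟩ ⟨j, c⟩
    by_cases hij : i = j
    · subst hij
      exact (h i).right_right b c
    · exact hN i j hij _ (hF i b) _ (hF j c)
  · rintro ⟨i, b⟩ ⟨j, c⟩ hne
    by_cases hij : i = j
    · subst hij
      exact (h i).left_right_ne b c fun hbc ↦ hne (by rw [hbc])
    · exact hN i j hij _ (hE i b) _ (hF j c)
  · rw [reverse_prod_ofFn_apply ηs E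
      (fun i j hij b c ↦ hN i j hij _ (hE i b) _ (hE j c)) hv, Fintype.sum_prod_type]

end NullInvolution

/-- two null involutions (products of basic null involutions supported on
pairwise orthogonal 4-dimensional subspaces) are `O(q,k)`-conjugate iff they have the same
number of basic factors. -/
theorem null_involutions_conjugate_iff_same_length
    {k V : Type*} [Field k] [CharP k 2] [AddCommGroup V] [Module k V] [FiniteDimensional k V]
    (Q : QuadraticForm k V)
    -- `V` is nonsingular
    (hns : ∀ v : V, (∀ w : V, polar Q v w = 0) → v = 0)
    {m n : ℕ}
    (ηs : Fin m → Module.End k V) (N : Fin m → Submodule k V)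
    (μs : Fin n → Module.End k V) (M : Fin n → Submodule k V)
    (hη : ∀ i, IsBasicNullOn Q (ηs i) (N i))
    (hμ : ∀ i, IsBasicNullOn Q (μs i) (M i))
    (hNorth : ∀ i j, i ≠ j → ∀ v ∈ N i, ∀ w ∈ N j, polar Q v w = 0)
    (hMorth : ∀ i j, i ≠ j → ∀ v ∈ M i, ∀ w ∈ M j, polar Q v w = 0) :
    (∃ φ : V ≃ₗ[k] V, (∀ w : V, Q (φ w) = Q w) ∧
      φ.toLinearMap ∘ₗ (List.ofFn ηs).reverse.prod ∘ₗ φ.symm.toLinearMap =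
        (List.ofFn μs).reverse.prod) ↔ m = n := by
  obtain ⟨E, F, hEF, hη'⟩ := exists_isHyperbolicFamily_reverse_prod hη hNorth
  obtain ⟨E', F', hEF', hμ'⟩ := exists_isHyperbolicFamily_reverse_prod hμ hMorth
  generalize (List.ofFn ηs).reverse.prod = g at *
  generalize (List.ofFn μs).reverse.prod = g' at *
  constructor
  · rintro ⟨φ, -, hφ⟩
    have hrange : LinearMap.range (g' - 1) =
        (LinearMap.range (g - 1)).map φ.toLinearMap := by
      have hconj : g' - 1 = φ.toLinearMap ∘ₗ (g - 1) ∘ₗ φ.symm.toLinearMap := by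
        ext v
        simp [← hφ]
      rw [hconj, ← LinearMap.comp_assoc,
        LinearMap.range_comp_of_range_eq_top _ (LinearEquiv.range φ.symm), LinearMap.range_comp]
    have h₁ := hEF.finrank_range g hη'
    have h₂ := hEF'.finrank_range g' hμ'
    rw [hrange, LinearEquiv.finrank_map_eq, h₁] at h₂
    omega
  · rintro rfl
    obtain ⟨φ, hφE, -⟩ := hEF.exists_isometryEquiv hEF'
    refine ⟨φ.toLinearEquiv, φ.map_app, LinearMap.ext fun w ↦ ?_⟩
    obtain ⟨v, rfl⟩ := φ.toLinearEquiv.surjective w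
    change φ (g (φ.toLinearEquiv.symm (φ.toLinearEquiv v))) = g' (φ v)
    rw [LinearEquiv.symm_apply_apply, hη', hμ']
    simp only [map_add, map_sum, map_smul, hφE]
    simp only [← hφE, polar_isometryEquiv]
end

section
/- Let k be a field of characteristic 2, let 0 ≤ j ≤ s, and let c_{j+1}, …, c_s ∈ k be nonzero elements that are linearly independent over the subfield k² of squares (equivalently, the totally singular form c_{j+1}z_{j+1}² + ⋯ + c_sz_s² is anisotropic). Define q : k^s → k by q(z₁,…,z_s) = c_{j+1}z_{j+1}² + ⋯ + c_sz_s². Then a k-linear automorphism of k^s preserves q if and only if its matrix with respect to the standard basis has block form [[χ, M],[0, I_{s−j}]] with χ an invertible j×j matrix over k and M an arbitrary j×(s−j) matrix over k. In particular, the orthogonal group O(q,k) is isomorphic to the semidirect product GL_j(k) ⋉ Mat_{j,s−j}(k), where GL_j(k) acts on the additive group Mat_{j,s−j}(k) by left multiplication. -/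
open Matrix

/-- The totally singular quadratic form `q(z) = c_{j+1}z_{j+1}² + ⋯ + c_s z_s²` on `k^s`
(indices `≥ j` in 0-indexed notation). -/
def qTS {k : Type*} [Field k] {s : ℕ} (j : ℕ) (c : Fin s → k) (z : Fin s → k) : k :=
  ∑ i ∈ Finset.univ.filter (fun i : Fin s => j ≤ (i : ℕ)), c i * z i ^ 2

/-- The group of linear automorphisms of `k^s` preserving a function `q : k^s → k`. -/
def orthSubgroup {k : Type*} [Field k] {s : ℕ} (q : (Fin s → k) → k) :
    Subgroup ((Fin s → k) ≃ₗ[k] (Fin s → k)) where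
  carrier := {g | ∀ z, q (g z) = q z}
  one_mem' := fun _ => rfl
  mul_mem' := by
    intro a b ha hb z
    have : (a * b) z = a (b z) := rfl
    rw [this, ha, hb]
  inv_mem' := by
    intro a ha z
    have h1 : a ((a⁻¹ : (Fin s → k) ≃ₗ[k] (Fin s → k)) z) = z := a.apply_symm_apply z
    calc q ((a⁻¹ : (Fin s → k) ≃ₗ[k] (Fin s → k)) z)
        = q (a ((a⁻¹ : (Fin s → k) ≃ₗ[k] (Fin s → k)) z)) := (ha _).symm
      _ = q z := by rw [h1]

/-- Left multiplication by an invertible `j×j` matrix, as an additive automorphism of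
`Mat_{j,m}(k)`. -/
def leftMulAddEquiv {k : Type*} [Field k] {j m : ℕ} (χ : GL (Fin j) k) :
    Matrix (Fin j) (Fin m) k ≃+ Matrix (Fin j) (Fin m) k where
  toFun M := (χ : Matrix (Fin j) (Fin j) k) * M
  invFun M := (↑χ⁻¹ : Matrix (Fin j) (Fin j) k) * M
  left_inv M := by
    show (↑χ⁻¹ : Matrix (Fin j) (Fin j) k) * ((↑χ : Matrix (Fin j) (Fin j) k) * M) = M
    rw [← Matrix.mul_assoc, ← Units.val_mul, inv_mul_cancel, Units.val_one, Matrix.one_mul]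
  right_inv M := by
    show (↑χ : Matrix (Fin j) (Fin j) k) * ((↑χ⁻¹ : Matrix (Fin j) (Fin j) k) * M) = M
    rw [← Matrix.mul_assoc, ← Units.val_mul, mul_inv_cancel, Units.val_one, Matrix.one_mul]
  map_add' M N := Matrix.mul_add _ _ _

/-- The action of `GL_j(k)` on the additive group `Mat_{j,m}(k)` by left multiplication,
as a homomorphism into the automorphism group of `Multiplicative (Mat_{j,m}(k))`. -/
def leftMulHom (k : Type*) [Field k] (j m : ℕ) :
    GL (Fin j) k →* MulAut (Multiplicative (Matrix (Fin j) (Fin m) k)) where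
  toFun χ := AddEquiv.toMultiplicative (leftMulAddEquiv χ)
  map_one' := by
    ext M
    simp [leftMulAddEquiv]
  map_mul' χ₁ χ₂ := by
    ext M
    simp [leftMulAddEquiv, Matrix.mul_assoc]

section

variable {k : Type*} [Field k] {s j : ℕ}

theorem qTS_sub [CharP k 2] (c x y : Fin s → k) :
    qTS j c (x - y) = qTS j c x - qTS j c y := by
  simp only [qTS, ← Finset.sum_sub_distrib, Pi.sub_apply, sub_pow_char, mul_sub]

theorem mem_orthSubgroup_qTS_iff [CharP k 2] (c : Fin s → k)
    (haniso : ∀ z : Fin s → k, qTS j c z = 0 → ∀ i : Fin s, j ≤ (i : ℕ) → z i = 0)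
    (g : (Fin s → k) ≃ₗ[k] (Fin s → k)) :
    g ∈ orthSubgroup (qTS j c) ↔ ∀ z, ∀ i : Fin s, j ≤ (i : ℕ) → g z i = z i := by
  constructor
  · intro h z i hi
    have hz : qTS j c (g z) = qTS j c z := h z
    exact sub_eq_zero.mp (haniso (g z - z) (by rw [qTS_sub, hz, sub_self]) i hi)
  · intro h z
    refine Finset.sum_congr rfl fun i hi => ?_
    rw [h z i (Finset.mem_filter.mp hi).2]

theorem toMatrix'_row_eq_one_iff (g : (Fin s → k) →ₗ[k] (Fin s → k)) (p : Fin s) :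
    (∀ q, LinearMap.toMatrix' g p q = if p = q then 1 else 0) ↔ ∀ z, g z p = z p := by
  constructor
  · intro h z
    rw [← LinearMap.toMatrix'_mulVec g z]
    simp [Matrix.mulVec, dotProduct, h]
  · intro h q
    rw [LinearMap.toMatrix'_apply, h, Pi.single_apply]

/-- The splitting of `s` coordinates into the first `j` and the last `s - j`. -/
def blockEquiv (hj : j ≤ s) : Fin j ⊕ Fin (s - j) ≃ Fin s :=
  finSumFinEquiv.trans (finCongr (Nat.add_sub_of_le hj))

@[simp] theorem blockEquiv_inl_val (hj : j ≤ s) (p : Fin j) :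
    (blockEquiv hj (Sum.inl p) : ℕ) = p := rfl

@[simp] theorem blockEquiv_inr_val (hj : j ≤ s) (p : Fin (s - j)) :
    (blockEquiv hj (Sum.inr p) : ℕ) = j + p := rfl

theorem rows_eq_one_iff (hj : j ≤ s) (A : Matrix (Fin s) (Fin s) k) :
    (∀ p q : Fin s, j ≤ (p : ℕ) → A p q = if p = q then 1 else 0) ↔
      A.submatrix (blockEquiv hj) (blockEquiv hj) =
        fromBlocks (A.submatrix (blockEquiv hj) (blockEquiv hj)).toBlocks₁₁
          (A.submatrix (blockEquiv hj) (blockEquiv hj)).toBlocks₁₂ 0 1 := by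
  constructor
  · intro h
    conv_lhs => rw [← fromBlocks_toBlocks (A.submatrix (blockEquiv hj) (blockEquiv hj))]
    congr 1
    · ext a b
      simp [toBlocks₂₁, h (blockEquiv hj (Sum.inr a)) _ (Nat.le_add_right _ _)]
    · ext a b
      simp [toBlocks₂₂, h (blockEquiv hj (Sum.inr a)) _ (Nat.le_add_right _ _), Matrix.one_apply]
  · intro h p q hp
    obtain ⟨a | a, rfl⟩ := (blockEquiv hj).surjective p
    · exact absurd hp (by simp)
    obtain ⟨b, rfl⟩ := (blockEquiv hj).surjective q
    have := congrFun (congrFun h (Sum.inr a)) b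
    rw [submatrix_apply] at this
    rw [this]
    rcases b with b | b <;> simp [Matrix.one_apply]

theorem isUnit_upperLeft_of_isUnit (hj : j ≤ s) (A : Matrix (Fin s) (Fin s) k) (hA : IsUnit A)
    (h : ∀ p q : Fin s, j ≤ (p : ℕ) → A p q = if p = q then 1 else 0) :
    IsUnit (Matrix.of fun p q : Fin j => A (Fin.castLE hj p) (Fin.castLE hj q)) := by
  rw [isUnit_iff_isUnit_det, ← det_submatrix_equiv_self (blockEquiv hj),
    (rows_eq_one_iff hj A).mp h, det_fromBlocks_zero₂₁, det_one, mul_one] at hA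
  rwa [isUnit_iff_isUnit_det]

variable (k) in
/-- The block matrix `[[χ, M],[0, I]]` attached to a pair `(M, χ)`, as a homomorphism. -/
def blockMatrixHom (hj : j ≤ s) :
    SemidirectProduct (Multiplicative (Matrix (Fin j) (Fin (s - j)) k))
      (GL (Fin j) k) (leftMulHom k j (s - j)) →* Matrix (Fin s) (Fin s) k where
  toFun x := (fromBlocks (x.right : Matrix (Fin j) (Fin j) k) x.left.toAdd 0 1).submatrix
    (blockEquiv hj).symm (blockEquiv hj).symm
  map_one' := by simp
  map_mul' x y := by
    rw [submatrix_mul_equiv, fromBlocks_multiply]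
    simp only [Matrix.mul_zero, Matrix.zero_mul, Matrix.mul_one, add_zero, zero_add]
    rw [add_comm]
    rfl

theorem submatrix_blockMatrixHom (hj : j ≤ s)
    (x : SemidirectProduct (Multiplicative (Matrix (Fin j) (Fin (s - j)) k))
      (GL (Fin j) k) (leftMulHom k j (s - j))) :
    (blockMatrixHom k hj x).submatrix (blockEquiv hj) (blockEquiv hj) =
      fromBlocks (x.right : Matrix (Fin j) (Fin j) k) x.left.toAdd 0 1 := by
  simp [blockMatrixHom]

theorem blockMatrixHom_injective (hj : j ≤ s) : Function.Injective (blockMatrixHom k hj) := by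
  intro x y h
  have h' := submatrix_blockMatrixHom hj x
  rw [h, submatrix_blockMatrixHom hj y, fromBlocks_inj] at h'
  exact SemidirectProduct.ext (Multiplicative.toAdd.injective h'.2.1.symm) (Units.ext h'.1.symm)

theorem blockMatrixHom_rows (hj : j ≤ s)
    (x : SemidirectProduct (Multiplicative (Matrix (Fin j) (Fin (s - j)) k))
      (GL (Fin j) k) (leftMulHom k j (s - j))) (p q : Fin s) (hp : j ≤ (p : ℕ)) :
    blockMatrixHom k hj x p q = if p = q then 1 else 0 := by
  refine (rows_eq_one_iff hj _).mpr ?_ p q hp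
  rw [submatrix_blockMatrixHom, toBlocks_fromBlocks₁₁, toBlocks_fromBlocks₁₂]

theorem exists_blockMatrixHom_eq (hj : j ≤ s) (A : Matrix (Fin s) (Fin s) k)
    (h : ∀ p q : Fin s, j ≤ (p : ℕ) → A p q = if p = q then 1 else 0)
    (hu : IsUnit (Matrix.of fun p q : Fin j => A (Fin.castLE hj p) (Fin.castLE hj q))) :
    ∃ x, blockMatrixHom k hj x = A := by
  obtain ⟨χ, hχ⟩ := hu
  refine ⟨⟨Multiplicative.ofAdd (A.submatrix (blockEquiv hj) (blockEquiv hj)).toBlocks₁₂, χ⟩, ?_⟩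
  have h' := (rows_eq_one_iff hj A).mp h
  have hinj : Function.Injective fun B : Matrix (Fin s) (Fin s) k =>
      B.submatrix (blockEquiv hj) (blockEquiv hj) :=
    (reindex (blockEquiv hj).symm (blockEquiv hj).symm).injective
  apply hinj
  dsimp only
  rw [submatrix_blockMatrixHom, h', hχ]
  rfl

variable (k) in
/-- The linear automorphism of `k^s` with matrix `[[χ, M],[0, I]]`, as a homomorphism. -/
def blockLinearHom (hj : j ≤ s) :
    SemidirectProduct (Multiplicative (Matrix (Fin j) (Fin (s - j)) k))
      (GL (Fin j) k) (leftMulHom k j (s - j)) →* ((Fin s → k) ≃ₗ[k] (Fin s → k)) :=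
  ((LinearMap.GeneralLinearGroup.generalLinearEquiv k (Fin s → k)).toMonoidHom.comp
    (Matrix.GeneralLinearGroup.toLin (n := Fin s) (R := k)).toMonoidHom).comp
      (blockMatrixHom k hj).toHomUnits

theorem toMatrix'_blockLinearHom (hj : j ≤ s)
    (x : SemidirectProduct (Multiplicative (Matrix (Fin j) (Fin (s - j)) k))
      (GL (Fin j) k) (leftMulHom k j (s - j))) :
    LinearMap.toMatrix' (blockLinearHom k hj x : (Fin s → k) →ₗ[k] (Fin s → k)) =
      blockMatrixHom k hj x :=
  LinearMap.toMatrix'_toLin' _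

theorem isUnit_toMatrix' (g : (Fin s → k) ≃ₗ[k] (Fin s → k)) :
    IsUnit (LinearMap.toMatrix' (g : (Fin s → k) →ₗ[k] (Fin s → k))) :=
  (isUnit_iff_isUnit_det _).mpr (by
    rw [LinearMap.det_toMatrix']
    exact LinearEquiv.isUnit_det' g)

theorem mem_orthSubgroup_qTS_iff_rows [CharP k 2] (c : Fin s → k)
    (haniso : ∀ z : Fin s → k, qTS j c z = 0 → ∀ i : Fin s, j ≤ (i : ℕ) → z i = 0)
    (g : (Fin s → k) ≃ₗ[k] (Fin s → k)) :
    g ∈ orthSubgroup (qTS j c) ↔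
      ∀ p q : Fin s, j ≤ (p : ℕ) →
        LinearMap.toMatrix' (g : (Fin s → k) →ₗ[k] (Fin s → k)) p q =
          if p = q then 1 else 0 := by
  rw [mem_orthSubgroup_qTS_iff c haniso]
  exact ⟨fun h p q hp => (toMatrix'_row_eq_one_iff (g : (Fin s → k) →ₗ[k] (Fin s → k)) p).mpr
      (fun z => h z p hp) q,
    fun h z p hp => (toMatrix'_row_eq_one_iff (g : (Fin s → k) →ₗ[k] (Fin s → k)) p).mp
      (fun q => h p q hp) z⟩

end

/-- for the totally singular anisotropic-on-the-tail form
`q(z) = ∑_{i ≥ j} cᵢzᵢ²` on `k^s` (char `k = 2`), a linear automorphism preserves `q` iff its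
matrix has block form `[[χ, M],[0, I]]` with `χ ∈ GL_j(k)`; consequently
`O(q,k) ≅ GL_j(k) ⋉ Mat_{j,s-j}(k)`. -/
theorem orthogonal_group_of_totally_singular_form
    {k : Type*} [Field k] [CharP k 2] (s j : ℕ) (hj : j ≤ s)
    (c : Fin s → k) (hc : ∀ i : Fin s, j ≤ (i : ℕ) → c i ≠ 0)
    (haniso : ∀ z : Fin s → k, qTS j c z = 0 → ∀ i : Fin s, j ≤ (i : ℕ) → z i = 0) :
    (∀ g : (Fin s → k) ≃ₗ[k] (Fin s → k),
      g ∈ orthSubgroup (qTS j c) ↔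
        ((∀ p q : Fin s, j ≤ (p : ℕ) →
            LinearMap.toMatrix' (g : (Fin s → k) →ₗ[k] (Fin s → k)) p q =
              if p = q then 1 else 0) ∧
          IsUnit (Matrix.of fun p q : Fin j =>
            LinearMap.toMatrix' (g : (Fin s → k) →ₗ[k] (Fin s → k))
              (Fin.castLE hj p) (Fin.castLE hj q)))) ∧
    Nonempty (orthSubgroup (qTS j c) ≃*
      SemidirectProduct (Multiplicative (Matrix (Fin j) (Fin (s - j)) k))
        (GL (Fin j) k) (leftMulHom k j (s - j))) := by
  refine ⟨fun g => ?_, ⟨(MulEquiv.ofBijective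
    ((blockLinearHom k hj).codRestrict (orthSubgroup (qTS j c)) fun x => ?_) ⟨?_, ?_⟩).symm⟩⟩
  · rw [mem_orthSubgroup_qTS_iff_rows c haniso]
    exact ⟨fun h => ⟨h, isUnit_upperLeft_of_isUnit hj _ (isUnit_toMatrix' g) h⟩, And.left⟩
  · rw [mem_orthSubgroup_qTS_iff_rows c haniso, toMatrix'_blockLinearHom]
    exact blockMatrixHom_rows hj x
  · intro x y h
    apply blockMatrixHom_injective hj
    rw [← toMatrix'_blockLinearHom, ← toMatrix'_blockLinearHom]
    exact congrArg (fun g : (Fin s → k) ≃ₗ[k] (Fin s → k) =>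
      LinearMap.toMatrix' (g : (Fin s → k) →ₗ[k] (Fin s → k))) (congrArg Subtype.val h)
  · rintro ⟨g, hg⟩
    have hrows := (mem_orthSubgroup_qTS_iff_rows c haniso g).mp hg
    obtain ⟨x, hx⟩ := exists_blockMatrixHom_eq hj _ hrows
      (isUnit_upperLeft_of_isUnit hj _ (isUnit_toMatrix' g) hrows)
    refine ⟨x, Subtype.ext (LinearEquiv.toLinearMap_injective (LinearMap.toMatrix'.injective ?_))⟩
    rw [← hx]
    exact toMatrix'_blockLinearHom hj x
end

section
/- Every radical involution ρ ∈ O(q,k) can be written as a finite product ρ = ρ_l ∘ ⋯ ∘ ρ_2 ∘ ρ_1 of basic radical involutions. More precisely, there is a basis {g₁, g₁', g₂, g₂', …, g_l, g_l', h_{l+1}, …, h_s} of rad(V) with ρ(g_i) = g_i' and ρ(g_i') = g_i for 1 ≤ i ≤ l and ρ(h_j) = h_j for l+1 ≤ j ≤ s, and each ρ_i is the basic radical involution swapping g_i and g_i' and fixing all the other listed basis vectors of rad(V) as well as a complement of rad(V). -/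
open QuadraticMap

/-- The radical `rad(V) = {v | ∀ w, B(v,w) = 0}` of the bilinear form associated to `Q`. -/
def qRadical {k V : Type*} [Field k] [AddCommGroup V] [Module k V]
    (Q : QuadraticForm k V) : Submodule k V where
  carrier := {v | ∀ w, polar Q v w = 0}
  add_mem' := by
    intro a b ha hb w
    rw [polar_add_left, ha, hb, add_zero]
  zero_mem' := fun w => polar_zero_left Q w
  smul_mem' := by
    intro c v hv w
    rw [polar_smul_left, hv, smul_zero]

/-- A radical involution: an element of `O(q,k)` of order 2 restricting to the identity on
some linear complement of `rad(V)`. -/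
def IsRadicalInvolution {k V : Type*} [Field k] [AddCommGroup V] [Module k V]
    (Q : QuadraticForm k V) (ρ : Module.End k V) : Prop :=
  Function.Bijective ρ ∧ (∀ w, Q (ρ w) = Q w) ∧ ρ * ρ = 1 ∧ ρ ≠ 1 ∧
    ∃ W : Submodule k V, IsCompl W (qRadical Q) ∧ ∀ w ∈ W, ρ w = w

/-- If the pairwise products of the elements of a list vanish, then the product of the
`1 + N` is `1` plus the sum of the `N`. -/
theorem List.prod_map_one_add_of_mul_eq_zero {R : Type*} [Ring R] (L : List R)
    (hL : ∀ a ∈ L, ∀ b ∈ L, a * b = 0) : (L.map (1 + ·)).prod = 1 + L.sum := by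
  induction L with
  | nil => simp
  | cons a L ih =>
    have ih' := ih fun x hx y hy => hL x (by simp [hx]) y (by simp [hy])
    have hz : a * L.sum = 0 := by
      suffices h : ∀ M : List R, (∀ b ∈ M, a * b = 0) → a * M.sum = 0 from
        h L fun b hb => hL a (by simp) b (by simp [hb])
      intro M hM
      induction M with
      | nil => simp
      | cons b M ihM =>
        rw [List.sum_cons, mul_add, hM b (by simp), ihM fun x hx => hM x (by simp [hx]), add_zero]
    rw [List.map_cons, List.prod_cons, ih', List.sum_cons, add_mul, one_mul, mul_add, hz]
    simp only [mul_one, add_zero]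
    abel

section Radical

variable {k V : Type*} [Field k] [AddCommGroup V] [Module k V] {Q : QuadraticForm k V}

theorem map_add_of_mem_qRadical (v : V) {r : V} (hr : r ∈ qRadical Q) :
    Q (v + r) = Q v + Q r := by
  have h : polar Q r v = 0 := hr v
  rw [polar_comm, polar] at h
  linear_combination h

theorem apply_mem_qRadical_of_involutive {ρ : Module.End k V} (hQ : ∀ w, Q (ρ w) = Q w)
    (hinv : ∀ v, ρ (ρ v) = v) {r : V} (hr : r ∈ qRadical Q) : ρ r ∈ qRadical Q := by
  intro w
  have h : polar Q r (ρ w) = 0 := hr _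
  rw [polar, ← hQ (r + ρ w), map_add, hinv, ← hQ r, hQ w] at h
  exact h

/-- `ρ - 1` takes values in `rad(V)`, and `Q` vanishes on these values. -/
theorem IsRadicalInvolution.sub_one_apply [CharP k 2] {ρ : Module.End k V}
    (hρ : IsRadicalInvolution Q ρ) (v : V) :
    ∃ r ∈ qRadical Q, (ρ - 1) r = (ρ - 1) v ∧ (ρ - 1) v ∈ qRadical Q ∧ Q ((ρ - 1) v) = 0 := by
  obtain ⟨-, hQ, hinv, -, W, hW, hfix⟩ := hρ
  have hv : v ∈ W ⊔ qRadical Q := by rw [hW.sup_eq_top]; trivial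
  obtain ⟨w, hw, r, hr, rfl⟩ := Submodule.mem_sup.1 hv
  have hρr := apply_mem_qRadical_of_involutive hQ (fun v => LinearMap.congr_fun hinv v) hr
  have h : (ρ - 1) (w + r) = ρ r - r := by simp [hfix w hw]
  refine ⟨r, hr, by simp [hfix w hw], ?_, ?_⟩
  · rw [h]; exact sub_mem hρr hr
  · rw [h, sub_eq_add_neg, map_add_of_mem_qRadical _ (neg_mem hr), QuadraticMap.map_neg, hQ,
      CharTwo.add_self_eq_zero]

end Radical

/-- A square-zero endomorphism `T` mapping a subspace `R` onto `range T ≤ R` admits vectors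
`e i` in `R` whose images form a basis of `range T`, and vectors `h j` in `ker T ⊓ R` which together
with the `e i` and `e i + T (e i)` form a basis of `R`. -/
theorem exists_basis_of_square_zero {k V : Type*} [Field k] [AddCommGroup V] [Module k V]
    [FiniteDimensional k V] (T : Module.End k V) (R : Submodule k V) (hT : ∀ v, T (T v) = 0)
    (hTR : ∀ v, T v ∈ R) (hsurj : ∀ v, ∃ r ∈ R, T r = T v) :
    ∃ (l m : ℕ) (b : Module.Basis (Fin l) k T.range) (e : Fin l → V) (h : Fin m → V),
      (∀ i, e i ∈ R) ∧ (∀ i, T (e i) = b i) ∧ (∀ j, h j ∈ R) ∧ (∀ j, T (h j) = 0) ∧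
      LinearIndependent k (Sum.elim (Sum.elim e fun i => e i + T (e i)) h) ∧
      Submodule.span k (Set.range (Sum.elim (Sum.elim e fun i => e i + T (e i)) h)) = R := by
  have hrange : T.range ≤ T.ker ⊓ R := by
    rintro _ ⟨v, rfl⟩
    exact ⟨hT v, hTR v⟩
  obtain ⟨C', hC'⟩ := exists_isCompl T.range
  obtain ⟨C, hC⟩ : ∃ C, C = C' ⊓ (T.ker ⊓ R) := ⟨_, rfl⟩
  have hsup : T.range ⊔ C = T.ker ⊓ R := by
    rw [hC, ← sup_inf_assoc_of_le _ hrange, hC'.sup_eq_top, top_inf_eq]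
  have hinf : T.range ⊓ C = ⊥ := by
    rw [hC, ← inf_assoc, hC'.inf_eq_bot, bot_inf_eq]
  let b := Module.finBasis k T.range
  let c := Module.finBasis k C
  have he : ∀ i, ∃ r ∈ R, T r = b i := by
    intro i
    obtain ⟨v, hv⟩ := (b i).2
    obtain ⟨r, hr, hrv⟩ := hsurj v
    exact ⟨r, hr, hrv.trans hv⟩
  choose e heR heb using he
  have hcK : ∀ j, (c j : V) ∈ T.ker ⊓ R := fun j => hsup ▸ Submodule.mem_sup_right (c j).2
  have hspan : Submodule.span k
      (Set.range (Sum.elim (Sum.elim e fun i => e i + T (e i)) fun j => (c j : V))) = R := by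
    set S := Submodule.span k
      (Set.range (Sum.elim (Sum.elim e fun i => e i + T (e i)) fun j => (c j : V))) with hS
    have heS : ∀ i, e i ∈ S := fun i => Submodule.subset_span ⟨.inl (.inl i), rfl⟩
    have hbS : ∀ i, (b i : V) ∈ S := fun i => by
      have : e i + T (e i) ∈ S := Submodule.subset_span ⟨.inl (.inr i), rfl⟩
      rw [← heb i]
      simpa using sub_mem this (heS i)
    have hcS : ∀ i, (c i : V) ∈ S := fun i => Submodule.subset_span ⟨.inr i, rfl⟩
    have hrS : T.range ≤ S := fun x hx => by
      have := congrArg (Subtype.val) (b.sum_repr ⟨x, hx⟩)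
      rw [← show _ = x from this, Submodule.coe_sum]
      exact sum_mem fun i _ => S.smul_mem _ (hbS i)
    have hCS : C ≤ S := fun x hx => by
      have := congrArg (Subtype.val) (c.sum_repr ⟨x, hx⟩)
      rw [← show _ = x from this, Submodule.coe_sum]
      exact sum_mem fun i _ => S.smul_mem _ (hcS i)
    apply le_antisymm
    · rw [hS, Submodule.span_le]
      rintro _ ⟨(i | i) | j, rfl⟩
      · exact heR i
      · exact add_mem (heR i) (hTR _)
      · exact (hcK j).2
    · intro v hv
      have hsumS : ∑ i, b.repr (T.rangeRestrict v) i • e i ∈ S :=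
        sum_mem fun i _ => S.smul_mem _ (heS i)
      have hsumR : ∑ i, b.repr (T.rangeRestrict v) i • e i ∈ R :=
        sum_mem fun i _ => R.smul_mem _ (heR i)
      have hsumT : T (∑ i, b.repr (T.rangeRestrict v) i • e i) = T v := by
        have := congrArg (Subtype.val) (b.sum_repr (T.rangeRestrict v))
        rw [Submodule.coe_sum] at this
        simpa [heb] using this
      have hker : v - ∑ i, b.repr (T.rangeRestrict v) i • e i ∈ T.ker ⊓ R :=
        Submodule.mem_inf.2
          ⟨by rw [LinearMap.mem_ker, map_sub, hsumT, sub_self], sub_mem hv hsumR⟩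
      rw [← hsup] at hker
      simpa using add_mem (sup_le hrS hCS hker) hsumS
  refine ⟨_, _, b, e, fun j => c j, heR, heb, fun j => (hcK j).2, fun j => (hcK j).1, ?_, hspan⟩
  rw [linearIndependent_iff_card_eq_finrank_span, Set.finrank, hspan]
  have h₁ := Submodule.finrank_sup_add_finrank_inf_eq T.range C
  rw [hsup, hinf, finrank_bot] at h₁
  have h₂ := LinearMap.finrank_range_add_finrank_ker (T.domRestrict R)
  have h₃ : (T.domRestrict R).range = T.range := by
    apply le_antisymm
    · rintro _ ⟨r, rfl⟩
      exact ⟨r, rfl⟩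
    · rintro _ ⟨v, rfl⟩
      obtain ⟨r, hr, hrv⟩ := hsurj v
      exact ⟨⟨r, hr⟩, hrv⟩
  have h₄ : Module.finrank k (T.domRestrict R).ker = Module.finrank k ↥(T.ker ⊓ R) := by
    have : (T.ker ⊓ R) = (T.domRestrict R).ker.map R.subtype := by
      ext x
      simp [and_comm]
    rw [this, Submodule.finrank_map_subtype_eq]
  rw [h₃, h₄] at h₂
  simp only [Fintype.card_sum, Fintype.card_fin]
  omega

/-- every radical involution is a finite product `ρ_l ∘ ⋯ ∘ ρ_1` of basic
radical involutions; more precisely there is a basis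
`{g₁, g₁', …, g_l, g_l', h₁, …, h_m}` of `rad(V)` with `ρ` swapping `g_i ↔ g_i'` and fixing
the `h_j`, and each `ρ_i` is the basic radical involution swapping `g_i` and `g_i'` while
fixing all the other listed basis vectors and a complement of `rad(V)`. -/
theorem radical_involution_eq_product_of_basic
    {k V : Type*} [Field k] [CharP k 2] [AddCommGroup V] [Module k V] [FiniteDimensional k V]
    (Q : QuadraticForm k V) (ρ : Module.End k V)
    (hρ : IsRadicalInvolution Q ρ) :
    ∃ (l m : ℕ) (g g' : Fin l → V) (h : Fin m → V) (ρs : Fin l → Module.End k V),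
      (∀ i, g i ∈ qRadical Q) ∧ (∀ i, g' i ∈ qRadical Q) ∧ (∀ j, h j ∈ qRadical Q) ∧
      LinearIndependent k (Sum.elim (Sum.elim g g') h) ∧
      Submodule.span k (Set.range (Sum.elim (Sum.elim g g') h)) = qRadical Q ∧
      (∀ i, ρ (g i) = g' i) ∧ (∀ i, ρ (g' i) = g i) ∧ (∀ j, ρ (h j) = h j) ∧
      (∀ i, Q (g i) = Q (g' i)) ∧
      (∀ i, Function.Bijective (ρs i) ∧ (∀ w, Q (ρs i w) = Q w) ∧
        ρs i (g i) = g' i ∧ ρs i (g' i) = g i ∧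
        (∀ j, j ≠ i → ρs i (g j) = g j ∧ ρs i (g' j) = g' j) ∧
        (∀ j, ρs i (h j) = h j) ∧
        (∃ W : Submodule k V, IsCompl W (qRadical Q) ∧ ∀ w ∈ W, ρs i w = w)) ∧
      ρ = (List.ofFn ρs).reverse.prod := by
  have hsub := hρ.sub_one_apply
  obtain ⟨-, -, hinv, -, W, hW, hfix⟩ := hρ
  have hV : ∀ v : V, v + v = 0 := fun v => by
    rw [← two_smul k, CharTwo.two_eq_zero, zero_smul]
  obtain ⟨T, hTdef⟩ : ∃ T, T = ρ - 1 := ⟨_, rfl⟩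
  simp only [← hTdef] at hsub
  have hρT : ∀ v, ρ v = v + T v := fun v => by simp [hTdef]
  have hT : ∀ v, T (T v) = 0 := fun v => by
    have h := LinearMap.congr_fun hinv v
    simp only [Module.End.mul_apply, hρT, map_add, Module.End.one_apply] at h
    have h' := hV (T v)
    rw [add_assoc, ← add_assoc (T v), h', zero_add] at h
    simpa using h
  have hTR : ∀ v, T v ∈ qRadical Q := fun v => by obtain ⟨r, -, -, h, -⟩ := hsub v; exact h
  have hTQ : ∀ v, Q (T v) = 0 := fun v => by obtain ⟨r, -, -, -, h⟩ := hsub v; exact h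
  have hsurj : ∀ v, ∃ r ∈ qRadical Q, T r = T v := fun v => by
    obtain ⟨r, hr, h, -⟩ := hsub v; exact ⟨r, hr, h⟩
  obtain ⟨l, m, b, e, h, heR, heb, hhR, hhT, hli, hspan⟩ :=
    exists_basis_of_square_zero T (qRadical Q) hT hTR hsurj
  let φ : Fin l → V →ₗ[k] k := fun i => b.coord i ∘ₗ T.rangeRestrict
  have hφ0 : ∀ i v, T v = 0 → φ i v = 0 := fun i v hv => by
    have : T.rangeRestrict v = 0 := Subtype.ext hv
    simp [φ, this]
  have hφe : ∀ i j, φ i (e j) = if j = i then 1 else 0 := fun i j => by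
    have : T.rangeRestrict (e j) = b j := Subtype.ext (heb j)
    simp [φ, this, Finsupp.single_apply]
  have hφT : ∀ v, ∑ i, φ i v • T (e i) = T v := fun v => by
    have := congrArg Subtype.val (b.sum_repr (T.rangeRestrict v))
    rw [Submodule.coe_sum] at this
    simpa [φ, heb] using this
  let N : Fin l → Module.End k V := fun i => (φ i).smulRight (T (e i))
  have hN : ∀ i v, (1 + N i) v = v + φ i v • T (e i) := fun i v => rfl
  have hNN : ∀ i j, N i * N j = 0 := fun i j => by
    ext v
    simp [N, hφ0 i _ (hT _)]
  have hNinv : ∀ i v, (1 + N i) ((1 + N i) v) = v := fun i v => by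
    rw [hN, hN, map_add, map_smul, hφ0 i _ (hT _), smul_zero, add_zero, add_assoc, hV, add_zero]
  refine ⟨l, m, e, fun i => e i + T (e i), h, fun i => 1 + N i, heR,
    fun i => add_mem (heR i) (hTR _), hhR, hli, hspan, fun i => hρT _, fun i => ?_,
    fun j => ?_, fun i => ?_, fun i => ⟨(Function.Involutive.bijective (hNinv i)), fun w => ?_,
      ?_, ?_, fun j hj => ⟨?_, ?_⟩, fun j => ?_, W, hW, fun w hw => ?_⟩, ?_⟩
  · rw [hρT, map_add, hT, add_zero, add_assoc, hV, add_zero]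
  · rw [hρT, hhT, add_zero]
  · rw [map_add_of_mem_qRadical _ (hTR _), hTQ, add_zero]
  · rw [hN, map_add_of_mem_qRadical _ (Submodule.smul_mem _ _ (hTR _)), QuadraticMap.map_smul,
      hTQ, smul_zero, add_zero]
  · simp [hN, hφe]
  · simp [hN, hφe, hφ0 i _ (hT _), add_assoc, hV]
  · simp [hN, hφe, hj]
  · simp [hN, hφe, hφ0 i _ (hT _), hj]
  · simp [hN, hφ0 i _ (hhT j)]
  · have hTw : T w = 0 := by simp [hTdef, hfix w hw]
    rw [hN, hφ0 i w hTw, zero_smul, add_zero]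
  · have hlist : (List.ofFn fun i => 1 + N i).reverse = (List.ofFn N).reverse.map (1 + ·) := by
      rw [List.map_reverse, List.map_ofFn]
      rfl
    rw [hlist, List.prod_map_one_add_of_mul_eq_zero, List.sum_reverse, List.sum_ofFn]
    · ext v
      simp [hρT, N, hφT]
    · intro x hx y hy
      simp only [List.mem_reverse, List.mem_ofFn] at hx hy
      obtain ⟨i, rfl⟩ := hx
      obtain ⟨j, rfl⟩ := hy
      exact hNN i j
end
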